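/- arXiv:2407.18350 — 2 statements merged into one kernel-verified Lean document; each statement's English description precedes it below -/
import Mathlib

section
/- For every integer d with d = 1 or 6 ≤ d ≤ 61, and every integer n ≥ 1, q_d^{(2)}(n) ≥ Q_d^{(2,−)}(n). (This settles Kang and Park's conjecture for these values of d.) -/
/-- q_d^{(a)}(n): the number of partitions of n into parts each ≥ a in which
any two parts differ by at least d. -/
def qPart (d a n : ℕ) : ℕ :=
  Fintype.card {p : Nat.Partition n //
    (∀ i ∈ p.parts, a ≤ i) ∧
    ∀ i ∈ p.parts, p.parts.count i = 1 ∧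
      ∀ j ∈ p.parts, j ≠ i → (d : ℤ) ≤ |(i : ℤ) - (j : ℤ)|}

/-- Q_d^{(a)}(n): the number of partitions of n into parts ≡ a or −a (mod d+3). -/
def QPart (d a n : ℕ) : ℕ :=
  Fintype.card {p : Nat.Partition n //
    ∀ i ∈ p.parts, (i : ZMod (d + 3)) = (a : ZMod (d + 3)) ∨
      (i : ZMod (d + 3)) = -(a : ZMod (d + 3))}

/-- Q_d^{(a,−)}(n): the number of partitions of n into parts ≡ a or −a (mod d+3)
with no part equal to d+3−a. -/
def QPartMinus (d a n : ℕ) : ℕ :=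
  Fintype.card {p : Nat.Partition n //
    (∀ i ∈ p.parts, (i : ZMod (d + 3)) = (a : ZMod (d + 3)) ∨
      (i : ZMod (d + 3)) = -(a : ZMod (d + 3))) ∧ (d + 3 - a) ∉ p.parts}

/-- The number of ways to write `n` as a sum of elements of the list `l`, order disregarded. -/
def partCount : List ℕ → ℕ → ℕ
  | [], n => if n = 0 then 1 else 0
  | s :: l, n => partCount l n + if 0 < s ∧ s ≤ n then partCount (s :: l) (n - s) else 0
termination_by l n => (l.length, n)
decreasing_by
  · exact Prod.Lex.left _ _ (by simp)
  · exact Prod.Lex.right _ (by omega)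

theorem partCount_nil (n : ℕ) : partCount [] n = if n = 0 then 1 else 0 := by
  rw [partCount]

theorem partCount_cons_of_lt {s n : ℕ} (l : List ℕ) (h : n < s) :
    partCount (s :: l) n = partCount l n := by
  rw [partCount, if_neg (by omega), add_zero]

theorem partCount_cons_of_le {s n : ℕ} (l : List ℕ) (hs : 0 < s) (h : s ≤ n) :
    partCount (s :: l) n = partCount l n + partCount (s :: l) (n - s) := by
  rw [partCount, if_pos ⟨hs, h⟩]

theorem partCount_cons_add {s : ℕ} (l : List ℕ) (hs : 0 < s) (n : ℕ) :
    partCount (s :: l) (n + s) = partCount l (n + s) + partCount (s :: l) n := by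
  rw [partCount_cons_of_le l hs (by omega), Nat.add_sub_cancel]

/-- Every family of multisets with sum `n` and elements in `l` has at most `partCount l n`
members. -/
theorem card_le_partCount (l : List ℕ) (hl : ∀ s ∈ l, 0 < s) (n : ℕ) (T : Finset (Multiset ℕ))
    (hT : ∀ t ∈ T, t.sum = n ∧ ∀ i ∈ t, i ∈ l) : T.card ≤ partCount l n := by
  induction l generalizing n T with
  | nil =>
    rw [partCount_nil]
    have h0 : ∀ t ∈ T, t = 0 := fun t ht =>
      Multiset.eq_zero_of_forall_notMem fun i hi => by simpa using (hT t ht).2 i hi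
    split_ifs with h
    · exact Finset.card_le_one.2 fun t ht u hu => by rw [h0 t ht, h0 u hu]
    · rw [Nat.le_zero, Finset.card_eq_zero]
      refine Finset.eq_empty_of_forall_notMem fun t ht => h ?_
      rw [← (hT t ht).1, h0 t ht, Multiset.sum_zero]
  | cons s l ih =>
    have hs : 0 < s := hl s (by simp)
    have hl' : ∀ i ∈ l, 0 < i := fun i hi => hl i (by simp [hi])
    induction n using Nat.strong_induction_on generalizing T with
    | _ n ihn =>
      have hsplit := Finset.card_filter_add_card_filter_not (s := T) (fun t => s ∈ t)
      have h1 : (T.filter fun t => ¬ s ∈ t).card ≤ partCount l n := by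
        refine ih hl' n _ fun t ht => ?_
        obtain ⟨ht, hst⟩ := Finset.mem_filter.1 ht
        refine ⟨(hT t ht).1, fun i hi => ?_⟩
        rcases List.mem_cons.1 ((hT t ht).2 i hi) with rfl | h
        · exact absurd hi hst
        · exact h
      by_cases hn : s ≤ n
      · rw [partCount_cons_of_le l hs hn]
        have h2 : (T.filter fun t => s ∈ t).card ≤ partCount (s :: l) (n - s) := by
          rw [← Finset.card_image_of_injOn (f := fun t : Multiset ℕ => t.erase s)]
          · refine ihn (n - s) (by omega) _ fun u hu => ?_
            obtain ⟨t, ht, rfl⟩ := Finset.mem_image.1 hu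
            obtain ⟨ht, hst⟩ := Finset.mem_filter.1 ht
            have := Multiset.sum_erase hst
            refine ⟨by have := (hT t ht).1; omega, fun i hi => ?_⟩
            exact (hT t ht).2 i (Multiset.mem_of_mem_erase hi)
          · intro t ht u hu h
            have ht := (Finset.mem_filter.1 ht).2
            have hu := (Finset.mem_filter.1 hu).2
            rw [← Multiset.cons_erase ht, ← Multiset.cons_erase hu]
            exact congrArg _ h
        omega
      · rw [partCount_cons_of_lt l (by omega)]
        have h2 : (T.filter fun t => s ∈ t) = ∅ := by
          refine Finset.filter_eq_empty_iff.2 fun t ht hst => hn ?_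
          rw [← (hT t ht).1]
          exact Multiset.single_le_sum (by simp) s hst
        rw [h2, Finset.card_empty] at hsplit
        omega

/-- The list `[m, m - 1, …, 1]`. -/
def downFrom : ℕ → List ℕ
  | 0 => []
  | m + 1 => (m + 1) :: downFrom m

/-- All elements of `s` are at least `a`, and any two of them differ by at least `d`. -/
def IsGapped (d a : ℕ) (s : Multiset ℕ) : Prop :=
  (∀ i ∈ s, a ≤ i) ∧
    ∀ i ∈ s, s.count i = 1 ∧ ∀ j ∈ s, j ≠ i → (d : ℤ) ≤ |(i : ℤ) - (j : ℤ)|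

theorem IsGapped.mono {d a b : ℕ} {s : Multiset ℕ} (h : IsGapped d b s) (hab : a ≤ b) :
    IsGapped d a s :=
  ⟨fun i hi => hab.trans (h.1 i hi), h.2⟩

theorem IsGapped.cons {d a : ℕ} {s : Multiset ℕ} (hd : 1 ≤ d) (h : IsGapped d (a + d) s) :
    IsGapped d a (a ::ₘ s) := by
  have ha : a ∉ s := fun ha => by have := h.1 a ha; omega
  refine ⟨fun i hi => ?_, fun i hi => ?_⟩
  · rcases Multiset.mem_cons.1 hi with rfl | hi
    · exact le_rfl
    · have := h.1 i hi; omega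
  · rcases Multiset.mem_cons.1 hi with rfl | his
    · refine ⟨by simp [Multiset.count_eq_zero_of_notMem ha], fun j hj hji => ?_⟩
      have := h.1 j ((Multiset.mem_cons.1 hj).resolve_left hji)
      rw [abs_sub_comm, le_abs]
      omega
    · have hia : i ≠ a := fun e => ha (e ▸ his)
      refine ⟨by rw [Multiset.count_cons_of_ne hia]; exact (h.2 i his).1, fun j hj hji => ?_⟩
      rcases Multiset.mem_cons.1 hj with rfl | hj
      · have := h.1 i his
        rw [le_abs]
        omega
      · exact (h.2 i his).2 j hj hji

theorem exists_gapped_family {d : ℕ} (hd : 1 ≤ d) (m N a : ℕ) :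
    ∃ T : Finset (Multiset ℕ), (∀ t ∈ T, IsGapped d a t ∧ t.card = m ∧
      t.sum = a * m + d * m.choose 2 + N) ∧ partCount (downFrom m) N ≤ T.card := by
  induction m generalizing N a with
  | zero =>
    rw [downFrom, partCount_nil]
    split_ifs with h
    · exact ⟨{0}, by simp [IsGapped, h], by simp⟩
    · exact ⟨∅, by simp, by simp⟩
  | succ m ih =>
    induction N using Nat.strong_induction_on generalizing a with
    | _ N ihN =>
      obtain ⟨T₁, hT₁, hc₁⟩ := ih N (a + d)
      have hcons : ∀ t ∈ T₁.image (a ::ₘ ·), a ∈ t ∧ IsGapped d a t ∧ t.card = m + 1 ∧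
          t.sum = a * (m + 1) + d * (m + 1).choose 2 + N := by
        intro t ht
        obtain ⟨u, hu, rfl⟩ := Finset.mem_image.1 ht
        obtain ⟨hg, hcard, hsum⟩ := hT₁ u hu
        refine ⟨by simp, hg.cons hd, by simp [hcard], ?_⟩
        rw [Multiset.sum_cons, hsum, Nat.choose_succ_succ' m 1, Nat.choose_one_right]
        ring
      have himg : (T₁.image (a ::ₘ ·)).card = T₁.card :=
        Finset.card_image_of_injective _ fun s t h => (Multiset.cons_inj_right a).1 h
      by_cases hN : m + 1 ≤ N
      · obtain ⟨T₂, hT₂, hc₂⟩ := ihN (N - (m + 1)) (by omega) (a + 1)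
        refine ⟨T₁.image (a ::ₘ ·) ∪ T₂, fun t ht => ?_, ?_⟩
        · rcases Finset.mem_union.1 ht with ht | ht
          · exact (hcons t ht).2
          · obtain ⟨hg, hcard, hsum⟩ := hT₂ t ht
            refine ⟨hg.mono (by omega), hcard, ?_⟩
            rw [hsum, add_mul]
            omega
        · rw [Finset.card_union_of_disjoint, himg, downFrom,
            partCount_cons_of_le _ (by omega) hN]
          · exact Nat.add_le_add hc₁ hc₂
          · rw [Finset.disjoint_left]
            intro t ht ht'
            have := (hT₂ t ht').1.1 a (hcons t ht).1
            omega
      · refine ⟨T₁.image (a ::ₘ ·), fun t ht => (hcons t ht).2, ?_⟩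
        rw [himg, downFrom, partCount_cons_of_lt _ (by omega)]
        exact hc₁

theorem card_le_qPart {d a n : ℕ} (ha : 0 < a) (T : Finset (Multiset ℕ))
    (hT : ∀ t ∈ T, IsGapped d a t ∧ t.sum = n) : T.card ≤ qPart d a n := by
  rw [← Fintype.card_coe, qPart]
  refine Fintype.card_le_of_injective
    (fun t : T => ⟨⟨t.1, fun hi => ha.trans_le ((hT t.1 t.2).1.1 _ hi), (hT t.1 t.2).2⟩,
      (hT t.1 t.2).1⟩) fun t u h => ?_
  exact Subtype.ext (congrArg (fun p => p.1.parts) h)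

/-- The sum of the parts of the smallest `m`-element multiset counted by `qPart d 2`. -/
def minSum (d m : ℕ) : ℕ := 2 * m + d * m.choose 2

theorem sum_partCount_le_qPart {d : ℕ} (hd : 1 ≤ d) (M n : ℕ) :
    (∑ m ∈ Finset.range M,
      if minSum d m ≤ n then partCount (downFrom m) (n - minSum d m) else 0) ≤ qPart d 2 n := by
  choose T hT hc using fun m => exists_gapped_family hd m (n - minSum d m) 2
  let U : ℕ → Finset (Multiset ℕ) := fun m => if minSum d m ≤ n then T m else ∅
  have hU : ∀ m, ∀ t ∈ U m, IsGapped d 2 t ∧ t.card = m ∧ t.sum = n := by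
    intro m t ht
    by_cases h : minSum d m ≤ n
    · simp only [U, if_pos h] at ht
      obtain ⟨h1, h2, h3⟩ := hT m t ht
      refine ⟨h1, h2, ?_⟩
      rw [h3]
      unfold minSum at h ⊢
      omega
    · simp [U, if_neg h] at ht
  calc _ ≤ ∑ m ∈ Finset.range M, (U m).card := by
        refine Finset.sum_le_sum fun m _ => ?_
        by_cases h : minSum d m ≤ n
        · simpa [U, if_pos h] using hc m
        · simp [if_neg h]
    _ = ((Finset.range M).biUnion U).card := by
        refine (Finset.card_biUnion fun m _ k _ hmk => Finset.disjoint_left.2 fun t ht ht' => ?_).symm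
        exact hmk ((hU m t ht).2.1.symm.trans (hU k t ht').2.1)
    _ ≤ qPart d 2 n := by
        refine card_le_qPart (by norm_num) _ fun t ht => ?_
        obtain ⟨m, -, ht⟩ := Finset.mem_biUnion.1 ht
        exact ⟨(hU m t ht).1, (hU m t ht).2.2⟩

theorem partCount_le_qPart {d : ℕ} (hd : 1 ≤ d) {m n : ℕ} (h : minSum d m ≤ n) :
    partCount (downFrom m) (n - minSum d m) ≤ qPart d 2 n := by
  refine le_trans ?_ (sum_partCount_le_qPart hd (m + 1) n)
  rw [Finset.sum_range_succ, if_pos h]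
  exact Nat.le_add_left _ _

/-- The numbers `j * K + 2` and `(j + 1) * K - 2` for `1 ≤ j ≤ J`. -/
def longParts (K : ℕ) : ℕ → List ℕ
  | 0 => []
  | J + 1 => ((J + 1) * K + 2) :: ((J + 2) * K - 2) :: longParts K J

theorem mem_longParts {K J j : ℕ} (hj : 1 ≤ j) (hJ : j ≤ J) :
    j * K + 2 ∈ longParts K J ∧ (j + 1) * K - 2 ∈ longParts K J := by
  induction J with
  | zero => omega
  | succ J ih =>
    rcases Nat.lt_or_ge J j with h | h
    · obtain rfl : j = J + 1 := by omega
      simp [longParts]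
    · simp [longParts, ih h]

theorem pos_of_mem_longParts {K J i : ℕ} (hK : 2 ≤ K) (hi : i ∈ longParts K J) : 0 < i := by
  induction J with
  | zero => simp [longParts] at hi
  | succ J ih =>
    simp only [longParts, List.mem_cons] at hi
    rcases hi with rfl | rfl | hi
    · omega
    · have : 2 * 2 ≤ (J + 2) * K := Nat.mul_le_mul (by omega) hK
      omega
    · exact ih hi

theorem QPartMinus_le_partCount (d n J : ℕ) (hn : n < J * (d + 3) + 3) :
    QPartMinus d 2 n ≤ partCount (2 :: longParts (d + 3) J) n := by
  rw [QPartMinus, Fintype.card_subtype]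
  rw [← Finset.card_image_of_injective (f := fun p : Nat.Partition n => p.parts) _
    (fun p q h => Nat.Partition.ext h)]
  refine card_le_partCount _ ?_ n _ ?_
  · intro i hi
    rcases List.mem_cons.1 hi with rfl | hi
    · norm_num
    · exact pos_of_mem_longParts (by omega) hi
  · intro t ht
    obtain ⟨p, hp, rfl⟩ := Finset.mem_image.1 ht
    obtain ⟨-, hp, hp'⟩ := Finset.mem_filter.1 hp
    refine ⟨p.parts_sum, fun i hi => ?_⟩
    have hin : i ≤ n := by
      rw [← p.parts_sum]
      exact Multiset.single_le_sum (by simp) i hi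
    have hipos := p.parts_pos hi
    rcases hp i hi with h | h
    · rw [ZMod.natCast_eq_natCast_iff'] at h
      rw [Nat.mod_eq_of_lt (by omega : 2 < d + 3)] at h
      have hdiv := Nat.div_add_mod i (d + 3)
      rw [h, mul_comm] at hdiv
      rcases Nat.eq_zero_or_pos (i / (d + 3)) with h0 | h0
      · rw [h0] at hdiv
        simp [← hdiv]
      · rw [← hdiv]
        refine List.mem_cons_of_mem _ (mem_longParts h0 ?_).1
        by_contra! hJ
        have : (J + 1) * (d + 3) ≤ i / (d + 3) * (d + 3) := Nat.mul_le_mul_right _ hJ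
        rw [add_mul] at this
        omega
    · have h2 : ((i + 2 : ℕ) : ZMod (d + 3)) = 0 := by
        push_cast
        rw [h]
        simp
      rw [ZMod.natCast_eq_zero_iff] at h2
      obtain ⟨j, hj⟩ := h2
      have hj0 : j ≠ 0 := by rintro rfl; omega
      have hj1 : j ≠ 1 := by
        rintro rfl
        refine hp' ?_
        convert hi using 1
        omega
      obtain ⟨k, rfl⟩ : ∃ k, j = k + 1 := ⟨j - 1, by omega⟩
      rw [mul_comm] at hj
      have hi' : i = (k + 1) * (d + 3) - 2 := by omega
      rw [hi']
      refine List.mem_cons_of_mem _ (mem_longParts (by omega) ?_).2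
      by_contra! hJ
      have : (J + 1 + 1) * (d + 3) ≤ (k + 1) * (d + 3) := Nat.mul_le_mul_right _ (by omega)
      rw [add_mul, add_mul] at this
      omega

section

open Real

theorem pow_le_factorial_mul_partCount (m N : ℕ) :
    N ^ m ≤ (m + 1).factorial * m.factorial * partCount (downFrom (m + 1)) N := by
  induction m generalizing N with
  | zero =>
    induction N with
    | zero => simp [downFrom, partCount_cons_of_lt, partCount_nil]
    | succ N ih =>
      rw [downFrom, partCount_cons_add _ (by norm_num)]
      simp [downFrom] at ih ⊢
      omega
  | succ m ih =>
    induction N using Nat.strong_induction_on with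
    | _ N ihN =>
      rw [downFrom]
      have h0 := ih N
      have e1 : (m + 1 + 1).factorial * (m + 1).factorial =
          (m + 2) * (m + 1) * ((m + 1).factorial * m.factorial) := by
        rw [Nat.factorial_succ (m + 1)]
        conv_lhs => rw [Nat.factorial_succ m]
        rw [Nat.factorial_succ m]
        ring
      by_cases hN : m + 1 + 1 ≤ N
      · rw [partCount_cons_of_le _ (by omega) hN, mul_add]
        have h1 := ihN (N - (m + 1 + 1)) (by omega)
        rw [downFrom] at h1
        have h2 : (m + 2) * (m + 1) * N ^ m ≤
            (m + 1 + 1).factorial * (m + 1).factorial * partCount (downFrom (m + 1)) N := by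
          rw [e1, mul_assoc (_ * _)]
          exact Nat.mul_le_mul_left _ h0
        refine le_trans ?_ (Nat.add_le_add h2 h1)
        obtain ⟨k, rfl⟩ := Nat.exists_eq_add_of_le hN
        rw [Nat.add_sub_cancel_left]
        have key : ∀ r x y : ℕ, (x + y) ^ (r + 1) ≤ x * (r + 1) * (x + y) ^ r + y ^ (r + 1) := by
          intro r x y
          induction r with
          | zero => simp
          | succ r ihr =>
            have hy : y ^ (r + 1) ≤ (x + y) ^ (r + 1) := Nat.pow_le_pow_left (by omega) _
            calc (x + y) ^ (r + 1 + 1) = (x + y) ^ (r + 1) * (x + y) := pow_succ _ _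
              _ = (x + y) ^ (r + 1) * x + (x + y) ^ (r + 1) * y := by ring
              _ ≤ (x + y) ^ (r + 1) * x + (x * (r + 1) * (x + y) ^ r + y ^ (r + 1)) * y := by gcongr
              _ ≤ (x + y) ^ (r + 1) * x + (x * (r + 1) * (x + y) ^ r * (x + y) + y ^ (r + 1) * y) := by
                rw [add_mul (x * (r + 1) * (x + y) ^ r)]
                gcongr
                omega
              _ = x * (r + 1 + 1) * (x + y) ^ (r + 1) + y ^ (r + 1 + 1) := by ring
        exact key m (m + 1 + 1) k
      · rw [partCount_cons_of_lt _ (by omega), e1, mul_assoc, pow_succ']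
        refine Nat.mul_le_mul ?_ h0
        calc N ≤ (m + 2) * 1 := by omega
          _ ≤ _ := Nat.mul_le_mul_left _ (by omega)

theorem sum_partCount_mul_pow_le {x : ℝ} (hx0 : 0 < x) (hx1 : x < 1) (l : List ℕ)
    (hl : ∀ s ∈ l, 0 < s) (M : ℕ) :
    ∑ k ∈ Finset.range M, partCount l k * x ^ k ≤ (l.map fun s => (1 - x ^ s)⁻¹).prod := by
  induction l generalizing M with
  | nil =>
    simp only [partCount_nil, List.map_nil, List.prod_nil]
    rcases M with _ | M
    · simp
    · rw [Finset.sum_range_succ']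
      simp
  | cons s l ih =>
    have hs : 0 < s := hl s (by simp)
    have ih := ih (fun i hi => hl i (by simp [hi])) M
    have hxs : x ^ s < 1 := pow_lt_one₀ hx0.le hx1 hs.ne'
    rw [List.map_cons, List.prod_cons, ← div_eq_inv_mul, le_div_iff₀ (by linarith)]
    have hrec : ∑ k ∈ Finset.range M, (partCount (s :: l) k : ℝ) * x ^ k ≤
        ∑ k ∈ Finset.range M, (partCount l k : ℝ) * x ^ k +
          (∑ k ∈ Finset.range M, (partCount (s :: l) k : ℝ) * x ^ k) * x ^ s := by
      rcases Nat.lt_or_ge M s with h | h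
      · refine (Finset.sum_le_sum fun k hk => ?_).trans (le_add_of_nonneg_right (by positivity))
        rw [partCount_cons_of_lt _ ((Finset.mem_range.1 hk).trans h)]
      · obtain ⟨r, rfl⟩ := Nat.exists_eq_add_of_le' h
        calc ∑ k ∈ Finset.range (r + s), (partCount (s :: l) k : ℝ) * x ^ k
            = ∑ k ∈ Finset.range (r + s), ((partCount l k : ℝ) * x ^ k +
                if s ≤ k then (partCount (s :: l) (k - s) : ℝ) * x ^ k else 0) := by
              refine Finset.sum_congr rfl fun k _ => ?_
              split_ifs with hk
              · rw [partCount_cons_of_le _ hs hk]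
                push_cast
                ring
              · rw [partCount_cons_of_lt _ (by omega), add_zero]
          _ = ∑ k ∈ Finset.range (r + s), (partCount l k : ℝ) * x ^ k +
                ∑ k ∈ Finset.range r, (partCount (s :: l) k : ℝ) * x ^ k * x ^ s := by
              rw [Finset.sum_add_distrib]
              congr 1
              rw [add_comm r s, Finset.sum_range_add, Finset.sum_eq_zero, zero_add]
              · refine Finset.sum_congr rfl fun k _ => ?_
                rw [if_pos (by omega), Nat.add_sub_cancel_left, pow_add]
                ring
              · intro k hk
                rw [if_neg (by have := Finset.mem_range.1 hk; omega)]
          _ ≤ _ := by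
              rw [← Finset.sum_mul]
              gcongr
              omega
    linarith

theorem partCount_mul_pow_le {x : ℝ} (hx0 : 0 < x) (hx1 : x < 1) (l : List ℕ)
    (hl : ∀ s ∈ l, 0 < s) (n : ℕ) :
    partCount l n * x ^ n ≤ (l.map fun s => (1 - x ^ s)⁻¹).prod := by
  refine le_trans ?_ (sum_partCount_mul_pow_le hx0 hx1 l hl (n + 1))
  exact Finset.single_le_sum (f := fun k => (partCount l k : ℝ) * x ^ k)
    (fun k _ => by positivity) (Finset.self_mem_range_succ n)

theorem partCount_cons_mul_pow_le {x : ℝ} (hx0 : 0 < x) (hx1 : x < 1) {s : ℕ} (hs : 0 < s)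
    (l : List ℕ) (hl : ∀ s ∈ l, 0 < s) (n : ℕ) :
    partCount (s :: l) n * x ^ n ≤ (l.map fun s => (1 - x ^ s)⁻¹).prod := by
  refine le_trans ?_ (sum_partCount_mul_pow_le hx0 hx1 l hl (n + 1))
  induction n using Nat.strong_induction_on with
  | _ n ih =>
    rw [Finset.sum_range_succ]
    by_cases h : s ≤ n
    · obtain ⟨k, rfl⟩ := Nat.exists_eq_add_of_le' h
      rw [partCount_cons_add _ hs]
      have h1 := ih k (by omega)
      have h2 : (partCount (s :: l) k : ℝ) * x ^ (k + s) ≤ partCount (s :: l) k * x ^ k := by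
        gcongr ?_ * ?_
        exact pow_le_pow_of_le_one hx0.le hx1.le (by omega)
      have h3 : ∑ j ∈ Finset.range (k + 1), (partCount l j : ℝ) * x ^ j ≤
          ∑ j ∈ Finset.range (k + s), (partCount l j : ℝ) * x ^ j :=
        Finset.sum_le_sum_of_subset_of_nonneg (Finset.range_subset_range.2 (by omega))
          fun _ _ _ => by positivity
      push_cast
      linarith
    · rw [partCount_cons_of_lt _ (by omega)]
      exact le_add_of_nonneg_left (Finset.sum_nonneg fun _ _ => by positivity)

theorem map_downFrom_prod (f : ℕ → ℝ) (m : ℕ) :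
    ((downFrom m).map f).prod = ∏ j ∈ Finset.range m, f (j + 1) := by
  induction m with
  | zero => simp [downFrom]
  | succ m ih => rw [downFrom, List.map_cons, List.prod_cons, ih, Finset.prod_range_succ, mul_comm]

theorem map_longParts_prod_le {x : ℝ} (hx0 : 0 < x) (hx1 : x < 1) {K : ℕ} (hK : 2 ≤ K) (J : ℕ) :
    ((longParts K J).map fun s => (1 - x ^ s)⁻¹).prod ≤
      (∏ j ∈ Finset.range J, (1 - (x ^ K) ^ (j + 1))⁻¹) *
        ∏ j ∈ Finset.range J, (1 - (x ^ K) ^ (j + 2))⁻¹ := by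
  have hlt : ∀ i, i ≠ 0 → x ^ i < 1 := fun i hi => pow_lt_one₀ hx0.le hx1 hi
  induction J with
  | zero => simp [longParts]
  | succ J ih =>
    rw [longParts, List.map_cons, List.prod_cons, List.map_cons, List.prod_cons,
      Finset.prod_range_succ, Finset.prod_range_succ]
    have hK2 : 2 * 1 ≤ (J + 1) * K := by nlinarith
    obtain ⟨e, he⟩ : ∃ e, (J + 2) * K = e + 2 :=
      ⟨(J + 2) * K - 2, by have : (J + 2) * K = (J + 1) * K + K := by ring
                           omega⟩
    have hle : (J + 1) * K ≤ e := by
      have : (J + 2) * K = (J + 1) * K + K := by ring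
      omega
    have key : (1 - x ^ ((J + 1) * K + 2))⁻¹ * (1 - x ^ ((J + 2) * K - 2))⁻¹ ≤
        (1 - (x ^ K) ^ (J + 1))⁻¹ * (1 - (x ^ K) ^ (J + 2))⁻¹ := by
      rw [← pow_mul, ← pow_mul, mul_comm K, mul_comm K, he, Nat.add_sub_cancel,
        ← mul_inv, ← mul_inv]
      have h1 := hlt ((J + 1) * K) (by omega)
      have h2 := hlt 2 (by omega)
      have h3 := hlt (e + 2) (by omega)
      have h4 : x ^ e ≤ x ^ ((J + 1) * K) := pow_le_pow_of_le_one hx0.le hx1.le hle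
      refine inv_anti₀ (mul_pos (by linarith) (by linarith)) ?_
      rw [pow_add, pow_add]
      nlinarith [mul_nonneg (sub_nonneg.2 h4) (sub_nonneg.2 h2.le)]
    have h0 : 0 ≤ ((longParts K J).map fun s => (1 - x ^ s)⁻¹).prod := by
      refine List.prod_nonneg fun a ha => ?_
      obtain ⟨s, hs, rfl⟩ := List.mem_map.1 ha
      exact inv_nonneg.2 (sub_nonneg.2 (hlt s (pos_of_mem_longParts hK hs).ne').le)
    have h1 : 0 ≤ (1 - (x ^ K) ^ (J + 1))⁻¹ * (1 - (x ^ K) ^ (J + 2))⁻¹ := by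
      rw [← pow_mul, ← pow_mul]
      have h1 := hlt (K * (J + 1)) (by positivity)
      have h2 := hlt (K * (J + 2)) (by positivity)
      exact mul_nonneg (inv_nonneg.2 (by linarith)) (inv_nonneg.2 (by linarith))
    calc _ = ((1 - x ^ ((J + 1) * K + 2))⁻¹ * (1 - x ^ ((J + 2) * K - 2))⁻¹) *
            ((longParts K J).map fun s => (1 - x ^ s)⁻¹).prod := by ring
      _ ≤ _ := mul_le_mul key ih h0 h1
      _ = _ := by ring

theorem inv_exp_sub_one_le {v : ℝ} (hv : 0 < v) :
    (exp v - 1)⁻¹ ≤ 1 / v - exp (-(v / 4)) / 2 := by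
  obtain ⟨z, rfl⟩ : ∃ z, v = 4 * z := ⟨v / 4, by ring⟩
  have hz : 0 < z := by linarith
  have cubic : ∀ u : ℝ, 0 ≤ u → 1 + u + u ^ 2 / 2 + u ^ 3 / 6 ≤ exp u := fun u hu => by
    have := Real.sum_le_exp_of_nonneg hu 4
    simp only [Finset.sum_range_succ, Finset.sum_range_zero] at this
    norm_num [Nat.factorial] at this
    linarith
  have h1 := cubic z hz.le
  have h4 := cubic (4 * z) hv.le
  have hE : exp (4 * z) - 1 > 0 := by nlinarith [pow_pos hz 2, pow_pos hz 3]
  rw [show 4 * z / 4 = z by ring, exp_neg, inv_eq_one_div, div_sub' hv.ne', div_le_div_iff₀ hE hv]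
  set E := exp z with hEdef
  have hEpos : 0 < E := exp_pos z
  have h2 : 0 ≤ E - 2 * z := by nlinarith [sq_nonneg (z - 1), pow_pos hz 3]
  have key : 0 ≤ exp (4 * z) * (E - 2 * z) - (1 + 4 * z) * E + 2 * z := by
    have h5 : (1 + 4 * z + (4 * z) ^ 2 / 2 + (4 * z) ^ 3 / 6) * (E - 2 * z) ≤
        exp (4 * z) * (E - 2 * z) := mul_le_mul_of_nonneg_right h4 h2
    have h6 : 0 ≤ (8 * z ^ 2 + 32 / 3 * z ^ 3) * (E - (1 + z + z ^ 2 / 2 + z ^ 3 / 6)) :=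
      mul_nonneg (by positivity) (by linarith)
    have h7 : 0 ≤ z ^ 3 * (8 / 3 - 20 / 3 * z + 20 / 3 * z ^ 2 + 16 / 9 * z ^ 3) := by
      refine mul_nonneg (by positivity) ?_
      nlinarith [sq_nonneg (2 * z - 1), pow_pos hz 3]
    nlinarith
  have h8 : (1 - 4 * z * (E⁻¹ / 2)) * (exp (4 * z) - 1) - 1 * (4 * z) =
      (exp (4 * z) * (E - 2 * z) - (1 + 4 * z) * E + 2 * z) * E⁻¹ := by
    field_simp
    ring
  have h9 := mul_nonneg key (inv_pos.2 hEpos).le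
  linarith

theorem sum_neg_log_one_sub_le {w : ℝ} (hw : 0 < w) (J : ℕ) :
    ∑ j ∈ Finset.range J, -log (1 - exp (-w) ^ (j + 1)) ≤
      π ^ 2 / (6 * w) + log (1 - exp (-(w / 4))) / 2 := by
  have hexp : ∀ u : ℝ, 0 < u → exp (-u) < 1 := fun u hu => exp_lt_one_iff.2 (by linarith)
  have habs : ∀ u : ℝ, 0 < u → ∀ j : ℕ, |exp (-u) ^ (j + 1)| < 1 := fun u hu j => by
    rw [abs_of_nonneg (by positivity)]
    exact pow_lt_one₀ (exp_pos _).le (hexp u hu) (by omega)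
  have hL := hasSum_sum fun (j : ℕ) (_ : j ∈ Finset.range J) =>
    hasSum_pow_div_log_of_abs_lt_one (habs w hw j)
  have hz : HasSum (fun k : ℕ => 1 / ((k : ℝ) + 1) ^ 2) (π ^ 2 / 6) := by
    have := (hasSum_nat_add_iff' 1).2 hasSum_zeta_two
    simpa using this
  have hg := hasSum_pow_div_log_of_abs_lt_one (x := exp (-(w / 4)))
    (by simpa using habs (w / 4) (by linarith) 0)
  have hR := (hz.mul_left w⁻¹).sub (hg.mul_left (1 / 2))
  refine (hasSum_le (fun k => ?_) hL hR).trans_eq (by field_simp; ring)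
  have hk : (0 : ℝ) < k + 1 := by positivity
  have hv : 0 < (k + 1) * w := by positivity
  have hr : exp (-((k + 1) * w)) < 1 := hexp _ hv
  have hgeom : ∑ j ∈ Finset.range J, (exp (-w) ^ (j + 1)) ^ (k + 1) ≤
      (exp ((k + 1) * w) - 1)⁻¹ := by
    have e : ∀ j : ℕ, (exp (-w) ^ (j + 1)) ^ (k + 1) =
        exp (-((k + 1) * w)) * exp (-((k + 1) * w)) ^ j := fun j => by
      rw [← pow_succ', ← exp_nat_mul, ← exp_nat_mul, ← exp_nat_mul]
      push_cast
      ring_nf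
    simp_rw [e]
    rw [← Finset.mul_sum]
    have h1 := (summable_geometric_of_lt_one (exp_pos _).le hr).sum_le_tsum (Finset.range J)
      (fun j _ => by positivity)
    rw [tsum_geometric_of_lt_one (exp_pos _).le hr] at h1
    refine (mul_le_mul_of_nonneg_left h1 (exp_pos _).le).trans_eq ?_
    rw [exp_neg] at hr ⊢
    have hE := exp_pos ((k + 1) * w)
    have hE1 : exp ((k + 1) * w) - 1 ≠ 0 := by
      have := one_lt_exp_iff.2 hv
      linarith
    rw [← mul_inv, mul_sub, mul_inv_cancel₀ hE.ne', mul_one]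
  have hb := hgeom.trans (inv_exp_sub_one_le hv)
  rw [← Finset.sum_div]
  calc _ ≤ (1 / ((k + 1) * w) - exp (-((k + 1) * w / 4)) / 2) / ((k : ℝ) + 1) := by gcongr
    _ = _ := by
      rw [← exp_nat_mul]
      push_cast
      rw [show ((k : ℝ) + 1) * -(w / 4) = -((k + 1) * w / 4) by ring]
      field_simp

theorem prod_inv_one_sub_le {w : ℝ} (hw : 0 < w) (J : ℕ) :
    ∏ j ∈ Finset.range J, (1 - exp (-w) ^ (j + 1))⁻¹ ≤
      exp (π ^ 2 / (6 * w)) * √(1 - exp (-(w / 4))) := by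
  have hpos : ∀ u : ℝ, 0 < u → ∀ j : ℕ, 0 < 1 - exp (-u) ^ (j + 1) := fun u hu j => by
    have := pow_lt_one₀ (exp_pos (-u)).le (exp_lt_one_iff.2 (by linarith : -u < 0)) j.add_one_ne_zero
    linarith
  have h := exp_le_exp.2 (sum_neg_log_one_sub_le hw J)
  rw [exp_sum, exp_add] at h
  have h4 : 0 < 1 - exp (-(w / 4)) := by simpa using hpos (w / 4) (by linarith) 0
  have e1 : exp (log (1 - exp (-(w / 4))) / 2) = √(1 - exp (-(w / 4))) := by
    rw [sqrt_eq_rpow, rpow_def_of_pos h4]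
    ring_nf
  rw [e1] at h
  refine le_trans (le_of_eq (Finset.prod_congr rfl fun j _ => ?_)) h
  rw [exp_neg (log _), exp_log (hpos w hw j)]

theorem partCount_downFrom_le {t : ℝ} (ht : 0 < t) (m n : ℕ) :
    (partCount (downFrom m) n : ℝ) ≤ exp (t * n + π ^ 2 / (6 * t)) := by
  have hl : ∀ s ∈ downFrom m, 0 < s := by
    induction m with
    | zero => simp [downFrom]
    | succ m ih => simpa [downFrom] using ih
  have h := partCount_mul_pow_le (exp_pos (-t)) (exp_lt_one_iff.2 (by linarith)) _ hl n
  rw [map_downFrom_prod (fun s => (1 - exp (-t) ^ s)⁻¹)] at h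
  have h1 : √(1 - exp (-(t / 4))) ≤ 1 := by
    rw [sqrt_le_one]
    linarith [exp_pos (-(t / 4))]
  have h2 := (h.trans (prod_inv_one_sub_le ht m)).trans
    (mul_le_of_le_one_right (exp_pos _).le h1)
  rw [← exp_nat_mul, mul_neg, exp_neg, ← div_eq_mul_inv, div_le_iff₀ (exp_pos _), ← exp_add] at h2
  rwa [add_comm, mul_comm (n : ℝ)] at h2

theorem partCount_longParts_le {t : ℝ} (ht : 0 < t) {K : ℕ} (hK : 2 ≤ K) (J n : ℕ) :
    (partCount (2 :: longParts K J) n : ℝ) ≤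
      exp (t * n + π ^ 2 / (3 * (K * t))) *
        ((1 - exp (-(K * t))) * (1 - exp (-(K * t / 4)))) := by
  have hx1 : exp (-t) < 1 := exp_lt_one_iff.2 (by linarith)
  have hw : 0 < K * t := by positivity
  have h := (partCount_cons_mul_pow_le (exp_pos (-t)) hx1 two_pos _
    (fun s hs => pos_of_mem_longParts hK hs) n).trans
    (map_longParts_prod_le (exp_pos (-t)) hx1 hK J)
  have ey : exp (-t) ^ K = exp (-(K * t)) := by
    rw [← exp_nat_mul]
    ring_nf
  have hy1 : exp (-(K * t)) < 1 := exp_lt_one_iff.2 (by linarith)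
  have h4 : exp (-(K * t / 4)) < 1 := exp_lt_one_iff.2 (by linarith)
  have hP := prod_inv_one_sub_le hw J
  have hP' := prod_inv_one_sub_le hw (J + 1)
  rw [ey] at h
  rw [Finset.prod_range_succ'] at hP'
  simp only [zero_add, pow_one] at hP'
  rw [mul_inv_le_iff₀ (by linarith)] at hP'
  have hnn : 0 ≤ ∏ j ∈ Finset.range J, (1 - exp (-(K * t)) ^ (j + 2))⁻¹ :=
    Finset.prod_nonneg fun j _ => inv_nonneg.2 <| sub_nonneg.2 <|
      pow_le_one₀ (exp_pos _).le hy1.le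
  have h5 := h.trans (mul_le_mul hP hP' hnn (by positivity))
  have e5 : exp (π ^ 2 / (6 * (K * t))) * √(1 - exp (-(K * t / 4))) *
      (exp (π ^ 2 / (6 * (K * t))) * √(1 - exp (-(K * t / 4))) * (1 - exp (-(K * t)))) =
      exp (π ^ 2 / (3 * (K * t))) * ((1 - exp (-(K * t))) * (1 - exp (-(K * t / 4)))) := by
    have e6 := mul_self_sqrt (sub_nonneg.2 h4.le)
    have e7 : exp (π ^ 2 / (3 * (K * t))) =
        exp (π ^ 2 / (6 * (K * t))) * exp (π ^ 2 / (6 * (K * t))) := by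
      rw [← exp_add]
      congr 1
      field_simp
      norm_num
    rw [e7]
    linear_combination exp (π ^ 2 / (6 * (K * t))) ^ 2 * (1 - exp (-(K * t))) * e6
  rw [e5, ← exp_nat_mul, mul_neg, exp_neg, ← div_eq_mul_inv, div_le_iff₀ (exp_pos _)] at h5
  rw [exp_add, mul_comm t]
  linarith

theorem factorial_le_exp_mul (k : ℕ) :
    ((k + 1).factorial : ℝ) ≤ exp 1 * √(k + 1) * ((k + 1) / exp 1) ^ (k + 1) := by
  have h := Stirling.stirlingSeq'_antitone (Nat.zero_le k)
  simp only [Function.comp, Nat.succ_eq_add_one, zero_add, Stirling.stirlingSeq_one] at h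
  rw [Stirling.stirlingSeq, div_le_iff₀ (by positivity)] at h
  push_cast at h
  refine h.trans_eq ?_
  rw [sqrt_mul zero_le_two]
  field_simp

theorem minSum_cast (d k : ℕ) :
    (minSum d (k + 1) : ℝ) = 2 * (k + 1) + d * (k * (k + 1)) / 2 := by
  rw [minSum]
  push_cast [Nat.cast_choose_two]
  ring

theorem le_log_sub_of_mem_Icc {a s c x y z : ℝ} (ha : 0 ≤ a) (hx : 0 < x) (hxy : x ≤ y)
    (hyz : y ≤ z) (h0 : c ≤ a * log x - s * x) (h1 : c ≤ a * log z - s * z) :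
    c ≤ a * log y - s * y := by
  have hconc : ConcaveOn ℝ (Set.Ioi 0) fun u : ℝ => a * log u - s * u := by
    have h2 : ConcaveOn ℝ (Set.Ioi (0 : ℝ)) fun u : ℝ => a * log u := by
      simpa using strictConcaveOn_log_Ioi.concaveOn.smul ha
    have h3 : ConvexOn ℝ (Set.Ioi (0 : ℝ)) fun u : ℝ => s * u :=
      ⟨convex_Ioi 0, fun u _ v _ p q _ _ _ => by simp only [smul_eq_mul]; apply le_of_eq; ring⟩
    exact h2.sub h3
  exact (le_min h0 h1).trans (hconc.min_le_of_mem_Icc hx (hx.trans_le (hxy.trans hyz)) ⟨hxy, hyz⟩)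

theorem QPartMinus_le_qPart_of_mem_block {d k n : ℕ} {ρ : ℝ} (hd : 6 ≤ d) (hk : 1 ≤ k)
    (hρ : ρ ≤ log (d / 2)) (h0 : d * (k + 1) ^ 2 ≤ n) (h1 : n ≤ d * (k + 2) ^ 2)
    (hdk : 4 * (k + 1 : ℝ) ≤ d * (k - 1))
    (hlow : (k + 1) * (2 * d / (d + 3) + π ^ 2 / 6) ≤ k * (ρ + 2))
    (hhigh : (k + 1) * (2 * d / (d + 3) + π ^ 2 / 6) + 2 * d / (d + 3) * (2 + 1 / (k + 1)) ≤
      k * (ρ + 2 + 4 / (k + 2))) :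
    QPartMinus d 2 n ≤ qPart d 2 n := by
  have hdR : (6 : ℝ) ≤ d := by exact_mod_cast hd
  have hkR : (1 : ℝ) ≤ k := by exact_mod_cast hk
  have hm : (0 : ℝ) < k + 1 := by linarith
  have h0R : (d : ℝ) * (k + 1) ^ 2 ≤ n := by exact_mod_cast h0
  have h1R : (n : ℝ) ≤ d * (k + 2) ^ 2 := by exact_mod_cast h1
  have hc := minSum_cast d k
  set c : ℝ := ((minSum d (k + 1) : ℕ) : ℝ) with hcdef
  have hy0 : (d : ℝ) / 2 * (k + 1) ^ 2 ≤ d * (k + 1) ^ 2 - c := by rw [hc]; nlinarith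
  have hy1 : (d : ℝ) / 2 * (k + 3) ^ 2 ≤ d * (k + 2) ^ 2 - c := by rw [hc]; nlinarith
  have hypos : (0 : ℝ) < d / 2 * (k + 1) ^ 2 := by positivity
  have hcn : minSum d (k + 1) ≤ n := by
    have : (minSum d (k + 1) : ℝ) ≤ n := by linarith
    exact_mod_cast this
  have hlow' := partCount_le_qPart (by omega : 1 ≤ d) hcn
  have hup := QPartMinus_le_partCount d n n (by nlinarith)
  set N := n - minSum d (k + 1) with hN
  have hNR : (N : ℝ) = n - c := by rw [hN, Nat.cast_sub hcn]
  have hNpos : (0 : ℝ) < N := by linarith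
  suffices h : (partCount (2 :: longParts (d + 3) n) n : ℝ) ≤ partCount (downFrom (k + 1)) N from
    hup.trans ((Nat.cast_le.1 h).trans hlow')
  set s : ℝ := 2 / ((d + 3) * (k + 1)) with hs
  have hspos : 0 < s := by positivity
  have hw : ((d + 3 : ℕ) : ℝ) * s = 2 / (k + 1) := by
    rw [hs]
    push_cast
    field_simp
  have hU := partCount_longParts_le hspos (by omega : 2 ≤ d + 3) n n
  rw [hw] at hU
  have hU' : (partCount (2 :: longParts (d + 3) n) n : ℝ) ≤
      exp (s * n + π ^ 2 * (k + 1) / 6) / (k + 1) ^ 2 := by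
    refine hU.trans ?_
    have a1 : 1 - exp (-(2 / ((k : ℝ) + 1))) ≤ 2 / (k + 1) := by
      linarith [add_one_le_exp (-(2 / ((k : ℝ) + 1)))]
    have a2 : 1 - exp (-(2 / ((k : ℝ) + 1) / 4)) ≤ 2 / (k + 1) / 4 := by
      linarith [add_one_le_exp (-(2 / ((k : ℝ) + 1) / 4))]
    have a3 : 0 ≤ 1 - exp (-(2 / ((k : ℝ) + 1) / 4)) := by
      have : exp (-(2 / ((k : ℝ) + 1) / 4)) ≤ 1 := exp_le_one_iff.2 (by
        have : 0 < 2 / ((k : ℝ) + 1) / 4 := by positivity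
        linarith)
      linarith
    calc _ ≤ exp (s * n + π ^ 2 / (3 * (2 / (k + 1)))) * (2 / (k + 1) * (2 / (k + 1) / 4)) := by
          gcongr
      _ = _ := by
          rw [show π ^ 2 / (3 * (2 / ((k : ℝ) + 1))) = π ^ 2 * (k + 1) / 6 by field_simp; norm_num]
          field_simp
          norm_num
  have hL : (N : ℝ) ^ k * exp (2 * k) / ((k : ℝ) + 1) ^ (2 * (k + 1)) ≤
      partCount (downFrom (k + 1)) N := by
    have b1 : (N : ℝ) ^ k ≤ (k + 1).factorial * k.factorial * partCount (downFrom (k + 1)) N := by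
      exact_mod_cast pow_le_factorial_mul_partCount k N
    have b2 := factorial_le_exp_mul k
    have b3 : ((k + 1).factorial : ℝ) = (k + 1) * k.factorial := by
      rw [Nat.factorial_succ]
      push_cast
      ring
    have b4 : ((k + 1).factorial : ℝ) * k.factorial * (k + 1) ≤
        exp 1 ^ 2 * (k + 1) * ((k + 1) / exp 1) ^ (2 * (k + 1)) := by
      calc _ = ((k + 1).factorial : ℝ) ^ 2 := by rw [b3]; ring
        _ ≤ (exp 1 * √(k + 1) * ((k + 1) / exp 1) ^ (k + 1)) ^ 2 := by gcongr
        _ = _ := by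
          rw [mul_pow, mul_pow, sq_sqrt hm.le, ← pow_mul, mul_comm (k + 1) 2]
    have b5 : ((k + 1).factorial : ℝ) * k.factorial ≤
        (k + 1) ^ (2 * (k + 1)) / exp (2 * k) := by
      have e1 : exp (2 * (k : ℝ)) = exp 1 ^ (2 * k) := by
        rw [← exp_nat_mul]
        push_cast
        ring_nf
      rw [e1]
      refine le_of_mul_le_mul_right (b4.trans_eq ?_) hm
      rw [div_pow, mul_add 2 k 1, pow_add (exp 1)]
      field_simp
    rw [div_le_iff₀ (by positivity)]
    calc (N : ℝ) ^ k * exp (2 * k)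
        ≤ ((k + 1).factorial * k.factorial * partCount (downFrom (k + 1)) N) * exp (2 * k) := by
          gcongr
      _ ≤ ((k + 1) ^ (2 * (k + 1)) / exp (2 * k) * partCount (downFrom (k + 1)) N) *
            exp (2 * k) := by gcongr
      _ = _ := by field_simp
  refine (hU'.trans ?_).trans hL
  have hσ : s * (d * (k + 1) ^ 2) = (k + 1) * (2 * d / (d + 3)) := by rw [hs]; field_simp
  have hσ' : s * (d * (k + 2) ^ 2) =
      (k + 1) * (2 * d / (d + 3)) + 2 * d / (d + 3) * (2 + 1 / (k + 1)) := by
    rw [hs]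
    field_simp
    ring
  have hlog0 : ρ + 2 * log (k + 1) ≤ log (d * (k + 1) ^ 2 - c) := by
    refine le_trans ?_ (log_le_log hypos hy0)
    rw [log_mul (by positivity) (by positivity), log_pow]
    push_cast
    linarith
  have hlog1 : ρ + 2 * log (k + 1) + 4 / (k + 2) ≤ log (d * (k + 2) ^ 2 - c) := by
    refine le_trans ?_ (log_le_log (by positivity) hy1)
    rw [log_mul (by positivity) (by positivity), log_pow]
    have := le_log_one_add_of_nonneg (x := 2 / ((k : ℝ) + 1)) (by positivity)
    rw [show 1 + 2 / ((k : ℝ) + 1) = (k + 3) / (k + 1) by field_simp; ring,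
      log_div (by positivity) (by positivity),
      show 2 * (2 / ((k : ℝ) + 1)) / (2 / (k + 1) + 2) = 2 / (k + 2) by field_simp; ring] at this
    have e : (4 : ℝ) / (k + 2) = 2 * (2 / (k + 2)) := by ring
    push_cast
    linarith
  have hmain : π ^ 2 * (k + 1) / 6 + 2 * k * log (k + 1) - 2 * k + s * c ≤
      k * log N - s * N := by
    refine le_log_sub_of_mem_Icc (x := d * (k + 1) ^ 2 - c) (z := d * (k + 2) ^ 2 - c)
      (zero_le_one.trans hkR) (hypos.trans_le hy0) (by linarith only [hNR, h0R])
      (by linarith only [hNR, h1R]) ?_ ?_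
    · have := mul_le_mul_of_nonneg_left hlog0 (zero_le_one.trans hkR)
      linarith only [this, hσ, hlow]
    · have := mul_le_mul_of_nonneg_left hlog1 (zero_le_one.trans hkR)
      linarith only [this, hσ', hhigh]
  have e1 : exp (k * log N) = (N : ℝ) ^ k := by rw [exp_nat_mul, exp_log hNpos]
  have e2 : exp (2 * k * log (k + 1)) = ((k : ℝ) + 1) ^ (2 * k) := by
    rw [show 2 * (k : ℝ) * log (k + 1) = (2 * k : ℕ) * log (k + 1) by push_cast; ring,
      exp_nat_mul, exp_log hm]
  rw [mul_add 2 k 1, pow_add, mul_one, ← div_div]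
  gcongr
  rw [le_div_iff₀ (by positivity), ← e1, ← e2, ← exp_add, ← exp_add, exp_le_exp]
  have : s * N = s * n - s * c := by rw [hNR]; ring
  linarith only [hmain, this]

theorem QPartMinus_le_qPart_of_large {d k n p q : ℕ} {σ : ℝ} (hd : 6 ≤ d) (hq : 0 < q)
    (hpq : 2 ^ (p + q) ≤ d ^ q) (hσ : 2 * d ≤ σ * (d + 3)) (hn : d * (k + 1) ^ 2 ≤ n)
    (hdk : 4 * (k + 1 : ℝ) ≤ 6 * (k - 1))
    (hlow : (k + 1) * (σ + 1.645) ≤ k * (0.69314 * p / q + 2))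
    (hhigh : (k + 1) * (σ + 1.645) + σ * (2 + 1 / (k + 1)) ≤
      k * (0.69314 * p / q + 2 + 4 / (k + 2))) :
    QPartMinus d 2 n ≤ qPart d 2 n := by
  have hdR : (6 : ℝ) ≤ d := by exact_mod_cast hd
  have hk0 : (0 : ℝ) ≤ k := k.cast_nonneg
  have hqR : (0 : ℝ) < q := by exact_mod_cast hq
  have hlog : 0.69314 * p / q ≤ log (d / 2) := by
    have h1 : log ((2 : ℝ) ^ (p + q)) ≤ log ((d : ℝ) ^ q) :=
      log_le_log (by positivity) (by exact_mod_cast hpq)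
    rw [log_pow, log_pow] at h1
    push_cast at h1
    rw [div_le_iff₀ hqR, log_div (by positivity) (by norm_num)]
    nlinarith [log_two_gt_d9, (p.cast_nonneg : (0 : ℝ) ≤ p)]
  have hπ : π ^ 2 / 6 ≤ 1.645 := by nlinarith [pi_lt_d4, pi_pos]
  set ρ : ℝ := 0.69314 * p / q
  have hσ' : 2 * (d : ℝ) / (d + 3) ≤ σ := by rwa [div_le_iff₀ (by positivity)]
  have hσ0 : 0 ≤ 2 * (d : ℝ) / (d + 3) := by positivity
  obtain ⟨j, hj⟩ : ∃ j, Nat.sqrt (n / d) = k + j + 1 := by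
    have : k + 1 ≤ Nat.sqrt (n / d) := by
      rw [Nat.le_sqrt', Nat.le_div_iff_mul_le (by omega)]
      linarith
    exact ⟨Nat.sqrt (n / d) - (k + 1), by omega⟩
  have hj0 : (0 : ℝ) ≤ j := j.cast_nonneg
  have hlt : n ≤ d * (k + j + 2) ^ 2 := by
    have h1 : n / d < (k + j + 2) ^ 2 := by
      have := Nat.lt_succ_sqrt' (n / d)
      rwa [hj] at this
    rw [Nat.div_lt_iff_lt_mul (by omega)] at h1
    linarith
  have hle : d * (k + j + 1) ^ 2 ≤ n := by
    have h1 : (k + j + 1) ^ 2 ≤ n / d := by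
      rw [← hj]
      exact Nat.sqrt_le' _
    rw [Nat.le_div_iff_mul_le (by omega)] at h1
    linarith
  have hk1 : (1 : ℝ) < k := by linarith
  have hslope : σ + 1.645 ≤ ρ + 2 := by
    have : k * (σ + 1.645) ≤ k * (ρ + 2) := by linarith
    exact le_of_mul_le_mul_left this (by linarith)
  have hS : (k + j + 1) * (2 * (d : ℝ) / (d + 3) + π ^ 2 / 6) ≤ (k + j + 1) * (σ + 1.645) := by
    gcongr
  have hjs := mul_le_mul_of_nonneg_left hslope hj0
  have hinc : k * (4 / (k + 2 : ℝ)) ≤ (k + j) * (4 / (k + j + 2)) := by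
    rw [mul_div_assoc', mul_div_assoc', div_le_div_iff₀ (by positivity) (by positivity)]
    nlinarith
  have hdec : 2 * (d : ℝ) / (d + 3) * (2 + 1 / (k + j + 1)) ≤ σ * (2 + 1 / (k + 1)) := by
    gcongr
    · exact hσ0.trans hσ'
    · exact le_add_of_nonneg_right hj0
  refine QPartMinus_le_qPart_of_mem_block (k := k + j) hd ?_ hlog hle hlt ?_ ?_ ?_
  · have : 1 < k := by exact_mod_cast hk1
    omega
  all_goals push_cast
  · nlinarith
  · linarith
  · linarith

/-- The number whose base `B` digits are the first `L` values of `f`. -/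
def encode (B L : ℕ) (f : ℕ → ℕ) : ℕ := ∑ n ∈ Finset.range L, f n * B ^ n

theorem encode_add (B L : ℕ) (f g : ℕ → ℕ) :
    encode B L (fun n => f n + g n) = encode B L f + encode B L g := by
  simp only [encode, add_mul, Finset.sum_add_distrib]

theorem encode_add_right_modEq (B L s : ℕ) (f : ℕ → ℕ) :
    encode B (L + s) f ≡ encode B L f [MOD B ^ L] := by
  rw [encode, Finset.sum_range_add]
  refine (Nat.ModEq.add_left _ (Nat.modEq_zero_iff_dvd.2 ?_)).trans (by rw [add_zero]; rfl)
  exact Finset.dvd_sum fun i _ => Dvd.dvd.mul_left (pow_dvd_pow B (Nat.le_add_right L i)) _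

theorem encode_shift_modEq (B L s : ℕ) (f : ℕ → ℕ) :
    encode B L (fun n => if s ≤ n then f (n - s) else 0) ≡ encode B L f * B ^ s
      [MOD B ^ L] := by
  refine (encode_add_right_modEq B L s _).symm.trans ?_
  have h : encode B (L + s) (fun n => if s ≤ n then f (n - s) else 0) = encode B L f * B ^ s := by
    rw [encode, add_comm L s, Finset.sum_range_add, Finset.sum_eq_zero, zero_add, encode,
      Finset.sum_mul]
    · refine Finset.sum_congr rfl fun n _ => ?_
      rw [if_pos (Nat.le_add_right s n), Nat.add_sub_cancel_left, pow_add]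
      ring
    · intro n hn
      rw [if_neg (by simpa using hn), zero_mul]
  rw [h]

theorem encode_div_pow_mod {B : ℕ} (hB : 0 < B) {L n : ℕ} {f : ℕ → ℕ} (hn : n < L)
    (hf : ∀ i < L, f i < B) : encode B L f / B ^ n % B = f n := by
  induction n generalizing L f with
  | zero =>
    obtain ⟨L, rfl⟩ : ∃ k, L = k + 1 := ⟨L - 1, by omega⟩
    rw [encode, Finset.sum_range_succ', pow_zero, Nat.div_one, mul_one, Nat.add_mod]
    simp only [pow_succ, ← mul_assoc, ← Finset.sum_mul, Nat.mul_mod_left, zero_add,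
      Nat.mod_mod]
    exact Nat.mod_eq_of_lt (hf 0 hn)
  | succ n ih =>
    obtain ⟨L, rfl⟩ : ∃ k, L = k + 1 := ⟨L - 1, by omega⟩
    rw [← ih (f := fun i => f (i + 1)) (by omega : n < L) (fun i hi => hf _ (by omega)),
      pow_succ', ← Nat.div_div_eq_div_mul]
    congr 2
    rw [encode, Finset.sum_range_succ']
    simp only [pow_succ, ← mul_assoc, ← Finset.sum_mul, pow_zero, mul_one]
    rw [add_comm, Nat.add_mul_div_right _ _ hB, Nat.div_eq_of_lt (hf 0 (by omega)), zero_add,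
      encode]

/-- Evaluates `k Z` after reducing `Z` to a numeral. -/
def withValue {α : Type} (Z : ℕ) (k : ℕ → α) : α :=
  match Z with
  | 0 => k 0
  | z + 1 => k (z + 1)

theorem withValue_eq {α : Type} (Z : ℕ) (k : ℕ → α) : withValue Z k = k Z := by
  cases Z <;> rfl

/-- Multiplies `Z` by `(1 + 2 ^ S) * (1 + 2 ^ (2 * S)) * (1 + 2 ^ (4 * S)) * ⋯`, with at most as
many factors as the second argument says, keeping only the lowest `W` bits, where
`mask = 2 ^ W - 1`. -/
def geomMul (W mask : ℕ) : ℕ → ℕ → ℕ → ℕ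
  | 0, _, Z => Z
  | r + 1, S, Z =>
    bif W.ble S then Z else
      withValue ((Z + Z <<< S) &&& mask) fun Z' =>
        withValue (2 * S) fun S' => geomMul W mask r S' Z'

theorem add_shiftLeft_and_modEq {b L s Z : ℕ} {f : ℕ → ℕ}
    (hZ : Z ≡ encode (2 ^ b) L f [MOD (2 ^ b) ^ L]) :
    (Z + Z <<< (b * s)) &&& (2 ^ (b * L) - 1) ≡
      encode (2 ^ b) L (fun n => f n + if s ≤ n then f (n - s) else 0) [MOD (2 ^ b) ^ L] := by
  rw [Nat.and_two_pow_sub_one_eq_mod, Nat.shiftLeft_eq, pow_mul, pow_mul, encode_add]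
  refine (Nat.mod_modEq _ _).trans (hZ.add ?_)
  exact (hZ.mul_right _).trans (encode_shift_modEq _ _ _ _).symm

theorem geomMul_modEq {b L : ℕ} (r s Z : ℕ) {f h : ℕ → ℕ} (hs : 0 < s) (hL : L ≤ 2 ^ r * s)
    (hZ : Z ≡ encode (2 ^ b) L f [MOD (2 ^ b) ^ L])
    (hh : ∀ n, h n = f n + if s ≤ n then h (n - s) else 0) :
    geomMul (b * L) (2 ^ (b * L) - 1) r (b * s) Z ≡ encode (2 ^ b) L h [MOD (2 ^ b) ^ L] := by
  have hsmall : L ≤ s → encode (2 ^ b) L f = encode (2 ^ b) L h := fun hLs =>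
    Finset.sum_congr rfl fun n hn => by
      rw [hh n, if_neg (by have := Finset.mem_range.1 hn; omega), add_zero]
  induction r generalizing s Z f with
  | zero => exact hsmall (by simpa using hL) ▸ hZ
  | succ r ih =>
    rw [geomMul]
    cases hc : (b * L).ble (b * s)
    · rw [cond_false, withValue_eq, withValue_eq, mul_left_comm]
      refine ih (2 * s) _ (by omega) (by rw [pow_succ] at hL; linarith)
        (add_shiftLeft_and_modEq hZ) (fun n => ?_) fun hLs => ?_
      · rw [hh n]
        by_cases h1 : s ≤ n
        · rw [if_pos h1, if_pos h1, hh (n - s)]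
          by_cases h2 : 2 * s ≤ n
          · rw [if_pos h2, if_pos (by omega), ← add_assoc]
            congr 2
            omega
          · rw [if_neg h2, if_neg (by omega), add_assoc]
        · rw [if_neg h1, if_neg h1, if_neg (by omega)]
      · refine Finset.sum_congr rfl fun n hn => ?_
        have := Finset.mem_range.1 hn
        dsimp only
        rw [hh n]
        by_cases h1 : s ≤ n
        · rw [if_pos h1, if_pos h1, hh (n - s), if_neg (by omega), add_zero]
        · rw [if_neg h1, if_neg h1]
    · rw [cond_true]
      rcases Nat.eq_zero_or_pos b with rfl | hb
      · simp [Nat.modEq_one]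
      · exact hsmall (Nat.le_of_mul_le_mul_left (Nat.le_of_ble_eq_true hc) hb) ▸ hZ

theorem partCount_cons (l : List ℕ) {s : ℕ} (hs : 0 < s) (n : ℕ) :
    partCount (s :: l) n = partCount l n + if s ≤ n then partCount (s :: l) (n - s) else 0 := by
  split_ifs with h
  · exact partCount_cons_of_le l hs h
  · exact partCount_cons_of_lt l (by omega)

theorem encode_partCount_nil {B L : ℕ} (hL : 0 < L) : encode B L (partCount []) = 1 := by
  rw [encode, Finset.sum_eq_single_of_mem 0 (Finset.mem_range.2 hL)]
  · simp [partCount_nil]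
  · intro n _ hn
    rw [partCount_nil, if_neg hn, zero_mul]

/-- The encoding of `partCount l`. -/
def encodeParts (b W mask r : ℕ) : List ℕ → ℕ
  | [] => 1
  | s :: l => withValue (encodeParts b W mask r l) fun Z =>
      withValue (b * s) fun S => geomMul W mask r S Z

theorem encodeParts_modEq {b L r : ℕ} (hL : 0 < L) (hr : L ≤ 2 ^ r) (l : List ℕ)
    (hl : ∀ s ∈ l, 0 < s) :
    encodeParts b (b * L) (2 ^ (b * L) - 1) r l ≡ encode (2 ^ b) L (partCount l)
      [MOD (2 ^ b) ^ L] := by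
  induction l with
  | nil => rw [encode_partCount_nil hL]; rfl
  | cons s l ih =>
    have hs := hl s (by simp)
    rw [encodeParts, withValue_eq, withValue_eq]
    exact geomMul_modEq r s _ hs (hr.trans (Nat.le_mul_of_pos_right _ hs))
      (ih fun i hi => hl i (by simp [hi])) (partCount_cons l hs)

/-- Adds to `acc` the numbers `P_i * 2 ^ (b * c_i)`, where `P_i` encodes `partCount (downFrom i)`
and `c_i = minSum d i`, for `m ≤ i < m + M`, starting from `P = P_m` and `c = c_m`. -/
def encodeGapped (d b W mask r : ℕ) : ℕ → ℕ → ℕ → ℕ → ℕ → ℕ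
  | 0, _, _, _, acc => acc
  | M + 1, m, c, P, acc =>
    withValue ((acc + P <<< (b * c)) &&& mask) fun acc' =>
      withValue (b * (m + 1)) fun S =>
        withValue (geomMul W mask r S P) fun P' =>
          withValue (c + (d * m + 2)) fun c' =>
            withValue (m + 1) fun m' => encodeGapped d b W mask r M m' c' P' acc'

theorem minSum_succ (d m : ℕ) : minSum d (m + 1) = minSum d m + (d * m + 2) := by
  rw [minSum, minSum, Nat.choose_succ_succ' m 1, Nat.choose_one_right]
  ring

/-- A lower bound for `qPart d 2 n`. -/
def gappedSum (d M n : ℕ) : ℕ :=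
  ∑ m ∈ Finset.range M,
    if minSum d m ≤ n then partCount (downFrom m) (n - minSum d m) else 0

theorem encodeGapped_modEq {d b L r : ℕ} (hr : L ≤ 2 ^ r) (M m P acc : ℕ)
    (hP : P ≡ encode (2 ^ b) L (partCount (downFrom m)) [MOD (2 ^ b) ^ L])
    (hacc : acc ≡ encode (2 ^ b) L (gappedSum d m) [MOD (2 ^ b) ^ L]) :
    encodeGapped d b (b * L) (2 ^ (b * L) - 1) r M m (minSum d m) P acc ≡
      encode (2 ^ b) L (gappedSum d (m + M)) [MOD (2 ^ b) ^ L] := by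
  induction M generalizing m P acc with
  | zero => exact hacc
  | succ M ih =>
    rw [encodeGapped]
    simp only [withValue_eq]
    rw [← minSum_succ, add_comm M 1, ← add_assoc]
    refine ih (m + 1) _ _ ?_ ?_
    · exact geomMul_modEq r (m + 1) _ m.succ_pos (hr.trans (Nat.le_mul_of_pos_right _ m.succ_pos))
        hP (partCount_cons (downFrom m) m.succ_pos)
    · have h : gappedSum d (m + 1) = fun n => gappedSum d m n +
          if minSum d m ≤ n then partCount (downFrom m) (n - minSum d m) else 0 :=
        funext fun n => Finset.sum_range_succ _ _
      rw [h, encode_add, Nat.and_two_pow_sub_one_eq_mod, Nat.shiftLeft_eq, pow_mul, pow_mul]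
      refine (Nat.mod_modEq _ _).trans (hacc.add ?_)
      exact (hP.mul_right _).trans (encode_shift_modEq _ _ _ _).symm

/-- Compares the lowest `2 ^ r` digits of `X` in base `2 ^ b` with those of `Y` in base
`2 ^ c`. -/
def digitsLe (b c : ℕ) : ℕ → ℕ → ℕ → Bool
  | 0, X, Y => (X % 2 ^ b).ble (Y % 2 ^ c)
  | _ + 1, 0, _ => true
  | r + 1, x + 1, Y =>
    withValue (x + 1) fun X => withValue (X >>> (b <<< r)) fun X₁ =>
      withValue (Y >>> (c <<< r)) fun Y₁ =>
        digitsLe b c r (X - X₁ <<< (b <<< r)) (Y - Y₁ <<< (c <<< r)) && digitsLe b c r X₁ Y₁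

theorem sub_shiftRight_shiftLeft (X b r : ℕ) :
    X - X >>> (b <<< r) <<< (b <<< r) = X % (2 ^ b) ^ 2 ^ r := by
  rw [Nat.shiftLeft_eq b, Nat.shiftRight_eq_div_pow, Nat.shiftLeft_eq, pow_mul]
  exact Nat.sub_eq_of_eq_add (Nat.mod_add_div' _ _).symm

theorem mod_pow_div_pow_mod {B X i S : ℕ} (h : i < S) : X % B ^ S / B ^ i % B = X / B ^ i % B := by
  obtain ⟨k, rfl⟩ := Nat.exists_eq_add_of_lt h
  rw [add_assoc, pow_add, Nat.mod_mul_right_div_self,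
    Nat.mod_mod_of_dvd _ (dvd_pow_self B k.succ_ne_zero)]

theorem digit_le_of_digitsLe {b c r X Y : ℕ} (h : digitsLe b c r X Y = true) {i : ℕ}
    (hi : i < 2 ^ r) : X / (2 ^ b) ^ i % 2 ^ b ≤ Y / (2 ^ c) ^ i % 2 ^ c := by
  induction r generalizing X Y i with
  | zero =>
    obtain rfl : i = 0 := by simpa using hi
    simpa using Nat.le_of_ble_eq_true h
  | succ r ih =>
    obtain _ | x := X
    · simp
    rw [digitsLe] at h
    simp only [withValue_eq, Bool.and_eq_true, sub_shiftRight_shiftLeft] at h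
    simp only [Nat.shiftLeft_eq, Nat.shiftRight_eq_div_pow, pow_mul] at h
    rcases Nat.lt_or_ge i (2 ^ r) with hir | hir
    · have := ih h.1 hir
      rwa [mod_pow_div_pow_mod hir, mod_pow_div_pow_mod hir] at this
    · obtain ⟨j, rfl⟩ := Nat.exists_eq_add_of_le hir
      have := ih h.2 (i := j) (by rw [pow_succ] at hi; omega)
      rwa [Nat.div_div_eq_div_mul, Nat.div_div_eq_div_mul, ← pow_add, ← pow_add] at this

/-- Checks `partCount (2 :: longParts (d + 3) J) n ≤ gappedSum d M n` for all `n < L`, provided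
that the left side is less than `2 ^ b` and the right side is less than `2 ^ c`. -/
def finiteCheck (d L J M b c r : ℕ) : Bool :=
  withValue (b * L) fun W => withValue (2 ^ (b * L) - 1) fun mask =>
    withValue (c * L) fun W' => withValue (2 ^ (c * L) - 1) fun mask' =>
      withValue (encodeParts b W mask r (2 :: longParts (d + 3) J)) fun X =>
        withValue (encodeGapped d c W' mask' r M 0 0 1 0) fun Y => digitsLe b c r X Y

theorem partCount_longParts_le_gappedSum {d L J M b c r : ℕ} (hL : L ≤ 2 ^ r)
    (hb : ∀ n < L, partCount (2 :: longParts (d + 3) J) n < 2 ^ b)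
    (hc : ∀ n < L, gappedSum d M n < 2 ^ c) (h : finiteCheck d L J M b c r = true) {n : ℕ}
    (hn : n < L) : partCount (2 :: longParts (d + 3) J) n ≤ gappedSum d M n := by
  have hL0 : 0 < L := by omega
  simp only [finiteCheck, withValue_eq] at h
  have hle := digit_le_of_digitsLe h (hn.trans_le hL)
  have hX := encodeParts_modEq (b := b) hL0 hL (2 :: longParts (d + 3) J) (fun s hs => by
    rcases List.mem_cons.1 hs with rfl | hs
    · norm_num
    · exact pos_of_mem_longParts (by omega) hs)
  have hY := encodeGapped_modEq (d := d) (b := c) hL M 0 1 0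
    (by rw [downFrom, encode_partCount_nil hL0]) (by simp [encode, gappedSum, Nat.ModEq.refl])
  rw [show minSum d 0 = 0 by simp [minSum], zero_add] at hY
  rw [← mod_pow_div_pow_mod hn, hX, mod_pow_div_pow_mod hn,
    encode_div_pow_mod (by positivity) hn hb,
    ← mod_pow_div_pow_mod (X := encodeGapped _ _ _ _ _ _ _ _ _ _) hn, hY, mod_pow_div_pow_mod hn, encode_div_pow_mod (by positivity) hn hc] at hle
  exact hle

theorem lt_two_pow_of_le_exp {x : ℕ} {y : ℝ} {b : ℕ} (hx : (x : ℝ) ≤ exp y)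
    (hy : y < 0.6931 * b) : x < 2 ^ b := by
  have h : exp y < 2 ^ b := by
    rw [← exp_log (by positivity : (0 : ℝ) < 2 ^ b), exp_lt_exp, log_pow]
    nlinarith [log_two_gt_d9, (b.cast_nonneg : (0 : ℝ) ≤ b)]
  exact_mod_cast hx.trans_lt h

theorem partCount_longParts_lt_two_pow {K J L k b n : ℕ} (hK : 2 ≤ K) (hk : 0 < k)
    (hb : 30000 * K * L + 98697 * k ^ 2 ≤ 20793 * b * k * K) (hn : n < L) :
    partCount (2 :: longParts K J) n < 2 ^ b := by
  have hkR : (0 : ℝ) < k := by exact_mod_cast hk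
  have hKR : (0 : ℝ) < K := by exact_mod_cast (by omega : 0 < K)
  have hnR : (n : ℝ) < L := by exact_mod_cast hn
  have hbR : 30000 * (K : ℝ) * L + 98697 * k ^ 2 ≤ 20793 * b * k * K := by exact_mod_cast hb
  have hπ : π ^ 2 < 9.8697 := by nlinarith [pi_lt_d6, pi_pos]
  refine lt_two_pow_of_le_exp ((partCount_longParts_le (t := 1 / k) (by positivity) hK J n).trans
    (mul_le_of_le_one_right (exp_pos _).le ?_)) ?_
  · have h : ∀ x : ℝ, 0 ≤ x → 0 ≤ 1 - exp (-x) ∧ 1 - exp (-x) ≤ 1 := fun x hx =>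
      ⟨sub_nonneg.2 (exp_le_one_iff.2 (neg_nonpos.2 hx)), by linarith [exp_pos (-x)]⟩
    obtain ⟨h1, h2⟩ := h (K * (1 / k)) (by positivity)
    obtain ⟨h3, h4⟩ := h (K * (1 / k) / 4) (by positivity)
    exact mul_le_one₀ h2 h3 h4
  · rw [show 1 / (k : ℝ) * n + π ^ 2 / (3 * (K * (1 / k))) =
      (3 * K * n + π ^ 2 * k ^ 2) / (3 * k * K) by field_simp, div_lt_iff₀ (by positivity)]
    have h1 : (K : ℝ) * n < K * L := by gcongr
    have h2 : π ^ 2 * (k : ℝ) ^ 2 ≤ 9.8697 * k ^ 2 := by gcongr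
    linarith

theorem gappedSum_lt_two_pow {d M L k b e n : ℕ} (hk : 0 < k) (hM0 : 0 < M) (hM : M ≤ 2 ^ e)
    (hb : 60000 * L + 98697 * k ^ 2 ≤ 41586 * b * k) (hn : n < L) :
    gappedSum d M n < 2 ^ (b + e) := by
  have hkR : (0 : ℝ) < k := by exact_mod_cast hk
  have hbR : 60000 * (L : ℝ) + 98697 * k ^ 2 ≤ 41586 * b * k := by exact_mod_cast hb
  have hπ : π ^ 2 < 9.8697 := by nlinarith [pi_lt_d6, pi_pos]
  have h : ∀ m i, i < L → partCount (downFrom m) i < 2 ^ b := by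
    intro m i hi
    have hiR : (i : ℝ) < L := by exact_mod_cast hi
    refine lt_two_pow_of_le_exp (partCount_downFrom_le (t := 1 / k) (by positivity) m i) ?_
    rw [show 1 / (k : ℝ) * i + π ^ 2 / (6 * (1 / k)) = (6 * i + π ^ 2 * k ^ 2) / (6 * k) by
      field_simp, div_lt_iff₀ (by positivity)]
    have h2 : π ^ 2 * (k : ℝ) ^ 2 ≤ 9.8697 * k ^ 2 := by gcongr
    linarith
  calc gappedSum d M n < ∑ _m ∈ Finset.range M, 2 ^ b := by
        refine Finset.sum_lt_sum_of_nonempty ⟨0, by simpa⟩ fun m _ => ?_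
        split_ifs
        · exact h m _ (by omega)
        · positivity
    _ = M * 2 ^ b := by simp
    _ ≤ 2 ^ (b + e) := by rw [pow_add, mul_comm]; gcongr

/-- Checks `QPartMinus d 2 n ≤ qPart d 2 n` for all `n < L`. The numbers `k` and `l` are used for
estimating that the quantities compared have at most `b` and `c + 6` bits. -/
def smallCheck (d L k b l c M r : ℕ) : Bool :=
  decide (L ≤ 2 ^ r ∧ 30000 * (d + 3) * L + 98697 * k ^ 2 ≤ 20793 * b * k * (d + 3) ∧
    60000 * L + 98697 * l ^ 2 ≤ 41586 * c * l) &&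
    finiteCheck d L (L / (d + 3) + 1) M b (c + 6) r

theorem QPartMinus_le_qPart_of_small {d L k b l c M r : ℕ} (hd : 1 ≤ d) (hk : 0 < k) (hl : 0 < l)
    (hM0 : 0 < M) (hM : M ≤ 64) (h : smallCheck d L k b l c M r = true) {n : ℕ} (hn : n < L) :
    QPartMinus d 2 n ≤ qPart d 2 n := by
  simp only [smallCheck, Bool.and_eq_true, decide_eq_true_eq] at h
  obtain ⟨⟨hr, hb, hc⟩, h⟩ := h
  have hJ : n < (L / (d + 3) + 1) * (d + 3) + 3 := by
    have := Nat.lt_div_mul_add (a := L) (b := d + 3) (by omega)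
    rw [add_mul]
    omega
  refine (QPartMinus_le_partCount d n _ hJ).trans
    ((partCount_longParts_le_gappedSum hr ?_ ?_ h hn).trans (sum_partCount_le_qPart hd M n))
  · exact fun i hi => partCount_longParts_lt_two_pow (by omega) hk hb hi
  · exact fun i hi => gappedSum_lt_two_pow hl hM0 hM hc hi

theorem QPartMinus_one_le (k : ℕ) : QPartMinus 1 2 (2 * k) ≤ (Nat.Partition.odds k).card := by
  rw [QPartMinus, Fintype.card_subtype]
  have hmod : ∀ p ∈ Finset.univ.filter (fun p : Nat.Partition (2 * k) =>
      (∀ i ∈ p.parts, (i : ZMod (1 + 3)) = ((2 : ℕ) : ZMod (1 + 3)) ∨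
        (i : ZMod (1 + 3)) = -((2 : ℕ) : ZMod (1 + 3))) ∧ 1 + 3 - 2 ∉ p.parts),
      ∀ i ∈ p.parts, i % 4 = 2 := by
    intro p hp i hi
    have h := (Finset.mem_filter.1 hp).2.1 i hi
    have h2 : -((2 : ℕ) : ZMod (1 + 3)) = ((2 : ℕ) : ZMod (1 + 3)) := by decide
    rw [h2, or_self, ZMod.natCast_eq_natCast_iff'] at h
    exact h
  have hinv : ∀ p : Nat.Partition (2 * k), (∀ i ∈ p.parts, i % 4 = 2) →
      (p.parts.map (· / 2)).map (2 * ·) = p.parts := by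
    intro p hp
    rw [Multiset.map_map]
    conv_rhs => rw [← Multiset.map_id p.parts]
    refine Multiset.map_congr rfl fun i hi => ?_
    have := hp i hi
    simp only [Function.comp, id]
    omega
  refine Finset.card_le_card_of_forall_subsingleton
    (fun p q => q.parts = p.parts.map (· / 2)) (fun p hp => ?_) fun q _ p hp p' hp' => ?_
  · have hp := hmod p hp
    have hsum : (p.parts.map (· / 2)).sum = k := by
      have h := congrArg Multiset.sum (hinv p hp)
      rw [Multiset.sum_map_mul_left, p.parts_sum, Multiset.map_id'] at h
      omega
    refine ⟨⟨p.parts.map (· / 2), fun {i} hi => ?_, hsum⟩, ?_, rfl⟩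
    · obtain ⟨j, hj, rfl⟩ := Multiset.mem_map.1 hi
      have := hp j hj
      omega
    · refine Finset.mem_filter.2 ⟨Finset.mem_univ _, ?_⟩
      intro i hi
      obtain ⟨j, hj, rfl⟩ := Multiset.mem_map.1 hi
      have := hp j hj
      rw [Nat.not_even_iff]
      omega
  · refine Nat.Partition.ext ?_
    rw [← hinv p (hmod p hp.1), ← hinv p' (hmod p' hp'.1), ← hp.2, ← hp'.2]

theorem card_distincts_le_qPart_one (k : ℕ) :
    (Nat.Partition.distincts k).card ≤ qPart 1 2 (2 * k) := by
  have hinj : Function.Injective fun p : Nat.Partition k => p.parts.map (2 * ·) := fun p q h =>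
    Nat.Partition.ext (Multiset.map_injective (mul_right_injective₀ two_ne_zero) h)
  rw [← Finset.card_image_of_injective _ hinj]
  refine card_le_qPart two_pos _ fun t ht => ?_
  obtain ⟨p, hp, rfl⟩ := Finset.mem_image.1 ht
  have hp : p.parts.Nodup := by simpa [Nat.Partition.distincts] using hp
  refine ⟨⟨fun i hi => ?_, fun i hi => ⟨?_, fun j hj hji => ?_⟩⟩, ?_⟩
  · obtain ⟨j, hj, rfl⟩ := Multiset.mem_map.1 hi
    have := p.parts_pos hj
    omega
  · exact Multiset.count_eq_one_of_mem (hp.map (mul_right_injective₀ two_ne_zero)) hi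
  · rw [le_abs]
    omega
  · rw [Multiset.sum_map_mul_left, Multiset.map_id', p.parts_sum]

theorem QPartMinus_le_qPart_one (n : ℕ) : QPartMinus 1 2 n ≤ qPart 1 2 n := by
  obtain ⟨k, rfl | rfl⟩ := n.even_or_odd'
  · refine (QPartMinus_one_le k).trans (le_trans ?_ (card_distincts_le_qPart_one k))
    rw [Nat.Partition.card_odds_eq_card_distincts]
  · refine le_trans (le_of_eq ?_) (Nat.zero_le _)
    rw [QPartMinus, Fintype.card_eq_zero_iff]
    refine ⟨fun p => ?_⟩
    have h : 2 ∣ p.1.parts.sum := Multiset.dvd_sum fun i hi => by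
      have h := p.2.1 i hi
      have h2 : -((2 : ℕ) : ZMod (1 + 3)) = ((2 : ℕ) : ZMod (1 + 3)) := by decide
      rw [h2, or_self, ZMod.natCast_eq_natCast_iff'] at h
      omega
    rw [p.1.parts_sum] at h
    omega

theorem QPartMinus_le_qPart_of_checks {d m n p q : ℕ} {σ : ℝ} {k b l c M r : ℕ} (hd : 6 ≤ d)
    (hq : 0 < q) (hpq : 2 ^ (p + q) ≤ d ^ q) (hσ : 2 * d ≤ σ * (d + 3))
    (hdk : 4 * (m + 1 : ℝ) ≤ 6 * (m - 1))
    (hlow : (m + 1) * (σ + 1.645) ≤ m * (0.69314 * p / q + 2))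
    (hhigh : (m + 1) * (σ + 1.645) + σ * (2 + 1 / (m + 1)) ≤
      m * (0.69314 * p / q + 2 + 4 / (m + 2)))
    (hk : 0 < k) (hl : 0 < l) (hM0 : 0 < M) (hM : M ≤ 64)
    (h : smallCheck d (d * (m + 1) ^ 2) k b l c M r = true) :
    QPartMinus d 2 n ≤ qPart d 2 n := by
  rcases Nat.lt_or_ge n (d * (m + 1) ^ 2) with hn | hn
  · exact QPartMinus_le_qPart_of_small (by omega) hk hl hM0 hM h hn
  · exact QPartMinus_le_qPart_of_large hd hq hpq hσ hn hdk hlow hhigh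

theorem QPartMinus_le_qPart_six (n : ℕ) : QPartMinus 6 2 n ≤ qPart 6 2 n := by
  have hcheck : smallCheck 6 (6 * (25 + 1) ^ 2) 93 112 48 236 37 12 = true := by
    decide +kernel
  refine QPartMinus_le_qPart_of_checks (m := 25) (p := 84) (q := 53) (σ := 667/500) (by norm_num)
    (by norm_num) (by norm_num) ?_ ?_ ?_ ?_ (by norm_num) (by norm_num) (by norm_num)
    (by norm_num) hcheck <;> norm_num

theorem QPartMinus_le_qPart_seven (n : ℕ) : QPartMinus 7 2 n ≤ qPart 7 2 n := by
  have hcheck : smallCheck 7 (7 * (15 + 1) ^ 2) 63 71 31 157 23 11 = true := by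
    decide +kernel
  refine QPartMinus_le_qPart_of_checks (m := 15) (p := 56) (q := 31) (σ := 7/5) (by norm_num)
    (by norm_num) (by norm_num) ?_ ?_ ?_ ?_ (by norm_num) (by norm_num) (by norm_num)
    (by norm_num) hcheck <;> norm_num

theorem QPartMinus_le_qPart_eight (n : ℕ) : QPartMinus 8 2 n ≤ qPart 8 2 n := by
  have hcheck : smallCheck 8 (8 * (11 + 1) ^ 2) 55 54 25 126 18 11 = true := by
    decide +kernel
  refine QPartMinus_le_qPart_of_checks (m := 11) (p := 2) (q := 1) (σ := 291/200) (by norm_num)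
    (by norm_num) (by norm_num) ?_ ?_ ?_ ?_ (by norm_num) (by norm_num) (by norm_num)
    (by norm_num) hcheck <;> norm_num

theorem QPartMinus_le_qPart_nine (n : ℕ) : QPartMinus 9 2 n ≤ qPart 9 2 n := by
  have hcheck : smallCheck 9 (9 * (9 + 1) ^ 2) 49 46 21 112 15 10 = true := by
    decide +kernel
  refine QPartMinus_le_qPart_of_checks (m := 9) (p := 13) (q := 6) (σ := 3/2) (by norm_num)
    (by norm_num) (by norm_num) ?_ ?_ ?_ ?_ (by norm_num) (by norm_num) (by norm_num)
    (by norm_num) hcheck <;> norm_num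

theorem QPartMinus_le_qPart_of_mem_Icc_10_12 {d : ℕ} (h0 : 10 ≤ d) (h1 : d ≤ 12) (n : ℕ) :
    QPartMinus d 2 n ≤ qPart d 2 n := by
  have hpq : 2 ^ (16 + 7) ≤ d ^ 7 :=
    le_trans (by norm_num) (Nat.pow_le_pow_left h0 7)
  have h1R : (d : ℝ) ≤ 12 := by exact_mod_cast h1
  have hcheck : smallCheck d (d * (10 + 1) ^ 2) 71 52 27 142 16 11 = true := by
    interval_cases d <;> decide +kernel
  refine QPartMinus_le_qPart_of_checks (m := 10) (σ := 8/5) (by omega) (by norm_num) hpq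
    (by linarith) ?_ ?_ ?_ (by norm_num) (by norm_num) (by norm_num) (by norm_num) hcheck <;>
    norm_num

theorem QPartMinus_le_qPart_of_mem_Icc_13_15 {d : ℕ} (h0 : 13 ≤ d) (h1 : d ≤ 15) (n : ℕ) :
    QPartMinus d 2 n ≤ qPart d 2 n := by
  have hpq : 2 ^ (8 + 3) ≤ d ^ 3 :=
    le_trans (by norm_num) (Nat.pow_le_pow_left h0 3)
  have h1R : (d : ℝ) ≤ 15 := by exact_mod_cast h1
  have hcheck : smallCheck d (d * (7 + 1) ^ 2) 60 39 23 115 12 10 = true := by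
    interval_cases d <;> decide +kernel
  refine QPartMinus_le_qPart_of_checks (m := 7) (σ := 1667/1000) (by omega) (by norm_num) hpq
    (by linarith) ?_ ?_ ?_ (by norm_num) (by norm_num) (by norm_num) (by norm_num) hcheck <;>
    norm_num

theorem QPartMinus_le_qPart_of_mem_Icc_16_31 {d : ℕ} (h0 : 16 ≤ d) (h1 : d ≤ 31) (n : ℕ) :
    QPartMinus d 2 n ≤ qPart d 2 n := by
  have hpq : 2 ^ (3 + 1) ≤ d ^ 1 :=
    le_trans (by norm_num) (Nat.pow_le_pow_left h0 1)
  have h1R : (d : ℝ) ≤ 31 := by exact_mod_cast h1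
  have hcheck : smallCheck d (d * (7 + 1) ^ 2) 105 42 34 165 12 11 = true := by
    interval_cases d <;> decide +kernel
  refine QPartMinus_le_qPart_of_checks (m := 7) (σ := 228/125) (by omega) (by norm_num) hpq
    (by linarith) ?_ ?_ ?_ (by norm_num) (by norm_num) (by norm_num) (by norm_num) hcheck <;>
    norm_num

theorem QPartMinus_le_qPart_of_mem_Icc_32_61 {d : ℕ} (h0 : 32 ≤ d) (h1 : d ≤ 61) (n : ℕ) :
    QPartMinus d 2 n ≤ qPart d 2 n := by
  have hpq : 2 ^ (4 + 1) ≤ d ^ 1 :=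
    le_trans (by norm_num) (Nat.pow_le_pow_left h0 1)
  have h1R : (d : ℝ) ≤ 61 := by exact_mod_cast h1
  have hcheck : smallCheck d (d * (5 + 1) ^ 2) 154 32 34 174 9 12 = true := by
    interval_cases d <;> decide +kernel
  refine QPartMinus_le_qPart_of_checks (m := 5) (σ := 2) (by omega) (by norm_num) hpq
    (by linarith) ?_ ?_ ?_ (by norm_num) (by norm_num) (by norm_num) (by norm_num) hcheck <;>
    norm_num

end

/-- Kang and Park's conjecture holds for d = 1 and for 6 ≤ d ≤ 61:
for every n ≥ 1, q_d^{(2)}(n) ≥ Q_d^{(2,−)}(n). -/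
theorem kang_park (d n : ℕ) (hd : d = 1 ∨ (6 ≤ d ∧ d ≤ 61)) (hn : 1 ≤ n) :
    QPartMinus d 2 n ≤ qPart d 2 n := by
  rcases hd with rfl | ⟨h6, h61⟩
  · exact QPartMinus_le_qPart_one n
  rcases Nat.lt_or_ge d 10 with h | h10
  · interval_cases d
    · exact QPartMinus_le_qPart_six n
    · exact QPartMinus_le_qPart_seven n
    · exact QPartMinus_le_qPart_eight n
    · exact QPartMinus_le_qPart_nine n
  rcases Nat.lt_or_ge d 13 with h | h13
  · exact QPartMinus_le_qPart_of_mem_Icc_10_12 h10 (by omega) n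
  rcases Nat.lt_or_ge d 16 with h | h16
  · exact QPartMinus_le_qPart_of_mem_Icc_13_15 h13 (by omega) n
  rcases Nat.lt_or_ge d 32 with h | h32
  · exact QPartMinus_le_qPart_of_mem_Icc_16_31 h16 (by omega) n
  · exact QPartMinus_le_qPart_of_mem_Icc_32_61 h32 h61 n
end

section
/- For every even integer d with 6 ≤ d ≤ 60 and every integer n ≥ 0, q_d^{(2)}(n) ≥ Q_d^{(2)}(n). -/
/-- The geometric power series `1 / (1 - X ^ s)`. -/
noncomputable def geomSeries (s : ℕ) : PowerSeries ℕ :=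
  PowerSeries.mk fun n => if s ∣ n then 1 else 0

theorem geomSeries_eq {s : ℕ} (hs : 0 < s) :
    geomSeries s = 1 + PowerSeries.X ^ s * geomSeries s := by
  ext n
  simp only [geomSeries, map_add, PowerSeries.coeff_mk, PowerSeries.coeff_one,
    PowerSeries.coeff_X_pow_mul']
  rcases lt_or_ge n s with h | h
  · rw [if_neg (not_le.2 h)]
    rcases Nat.eq_zero_or_pos n with rfl | hn
    · simp
    · rw [if_neg (Nat.not_dvd_of_pos_of_lt hn h), if_neg (by omega), add_zero]
  · rw [if_pos h, if_neg (by omega : ¬ n = 0), zero_add]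
    exact if_congr (Nat.dvd_sub_iff_left h dvd_rfl).symm rfl rfl

theorem coeff_geomSeries_mul {s : ℕ} (hs : 0 < s) (f : PowerSeries ℕ) (n : ℕ) :
    PowerSeries.coeff n (geomSeries s * f) = PowerSeries.coeff n f +
      if s ≤ n then PowerSeries.coeff (n - s) (geomSeries s * f) else 0 := by
  conv_lhs => rw [geomSeries_eq hs, add_mul, one_mul, mul_assoc]
  rw [map_add, PowerSeries.coeff_X_pow_mul']

/-- The partitions of `n` with all parts in `S` are counted by `∏ s ∈ S, 1 / (1 - X ^ s)`. -/
theorem card_partition_parts_mem_le (S : Finset ℕ) (hS : ∀ s ∈ S, 0 < s) (n : ℕ) :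
    ((Finset.univ : Finset n.Partition).filter fun p => ∀ i ∈ p.parts, i ∈ S).card ≤
      PowerSeries.coeff n (∏ s ∈ S, geomSeries s) := by
  induction S using Finset.induction_on generalizing n with
  | empty =>
    rw [Finset.prod_empty, PowerSeries.coeff_one]
    rcases Nat.eq_zero_or_pos n with rfl | hn
    · rw [if_pos rfl]
      exact (Finset.card_le_univ _).trans (by simp)
    · rw [if_neg hn.ne', Nat.le_zero, Finset.card_eq_zero, Finset.filter_eq_empty_iff]
      intro p _ hp
      have h0 : p.parts = 0 := Multiset.eq_zero_of_forall_notMem fun a ha => by simpa using hp a ha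
      have := p.parts_sum
      rw [h0] at this
      simp at this
      omega
  | insert s S hs ih =>
    have hs0 : 0 < s := hS s (Finset.mem_insert_self _ _)
    have ih' := ih fun t ht => hS t (Finset.mem_insert_of_mem ht)
    rw [Finset.prod_insert hs]
    induction n using Nat.strong_induction_on with
    | _ n ihn =>
      rw [coeff_geomSeries_mul hs0]
      rw [← Finset.card_filter_add_card_filter_not (fun p : n.Partition => s ∉ p.parts)]
      refine add_le_add ((Finset.card_le_card ?_).trans (ih' n)) ?_
      · intro p
        simp only [Finset.mem_filter, Finset.mem_univ, true_and]
        rintro ⟨h1, h2⟩ i hi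
        exact (Finset.mem_insert.1 (h1 i hi)).resolve_left (by rintro rfl; exact h2 hi)
      · split_ifs with hsn
        · refine le_trans ?_ (ihn (n - s) (by omega))
          refine Finset.card_le_card_of_injOn (fun p => if h : s ∈ p.parts then
            { parts := p.parts.erase s
              parts_pos := fun hi => p.parts_pos (Multiset.mem_of_mem_erase hi)
              parts_sum := by
                have := p.parts_sum
                rw [← Multiset.cons_erase h, Multiset.sum_cons] at this
                omega } else Nat.Partition.indiscrete (n - s)) ?_ ?_
          · intro p
            simp only [Finset.coe_filter, Finset.mem_univ, true_and, Set.mem_ofPred_eq, not_not,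
              Finset.mem_filter]
            rintro ⟨h1, h2⟩ i
            rw [dif_pos h2]
            exact fun hi => h1 i (Multiset.mem_of_mem_erase hi)
          · intro p hp q hq hpq
            simp only [Finset.coe_filter, Finset.mem_univ, true_and, Set.mem_ofPred_eq, not_not,
              Finset.mem_filter] at hp hq
            simp only [dif_pos hp.2, dif_pos hq.2, Nat.Partition.mk.injEq] at hpq
            ext1
            rw [← Multiset.cons_erase hp.2, ← Multiset.cons_erase hq.2, hpq]
        · rw [Nat.le_zero, Finset.card_eq_zero, Finset.filter_eq_empty_iff]
          intro p _ hp
          rw [not_not] at hp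
          exact hsn ((Multiset.single_le_sum (fun _ _ => Nat.zero_le _) s hp).trans_eq p.parts_sum)

/-- The generating function of the partitions into parts `2 + M i` and `M - 2 + M i`, `i < I`. -/
noncomputable def modSeries (M I : ℕ) : PowerSeries ℕ :=
  (∏ i ∈ Finset.range I, geomSeries (2 + M * i)) *
    ∏ i ∈ Finset.range I, geomSeries (M - 2 + M * i)

/-- The parts counted by `modSeries`. -/
def modParts (M I : ℕ) : Finset ℕ :=
  (Finset.range I).image (fun i => 2 + M * i) ∪ (Finset.range I).image fun i => M - 2 + M * i

@[to_additive]
theorem prod_modParts {β : Type*} [CommMonoid β] {M : ℕ} (hM : 5 ≤ M) (I : ℕ) (f : ℕ → β) :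
    ∏ s ∈ modParts M I, f s =
      (∏ i ∈ Finset.range I, f (2 + M * i)) * ∏ i ∈ Finset.range I, f (M - 2 + M * i) := by
  rw [modParts, Finset.prod_union, Finset.prod_image, Finset.prod_image]
  · intro i _ j _ h
    exact Nat.eq_of_mul_eq_mul_left (by omega : 0 < M) (Nat.add_left_cancel h)
  · intro i _ j _ h
    exact Nat.eq_of_mul_eq_mul_left (by omega : 0 < M) (Nat.add_left_cancel h)
  · rw [Finset.disjoint_left]
    simp only [Finset.mem_image, not_exists, not_and]
    rintro _ ⟨i, _, rfl⟩ j _ h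
    have := congrArg (· % M) h
    simp only [Nat.add_mul_mod_self_left] at this
    rw [Nat.mod_eq_of_lt (by omega), Nat.mod_eq_of_lt (by omega)] at this
    omega

theorem pos_of_mem_modParts {M I s : ℕ} (hM : 5 ≤ M) (hs : s ∈ modParts M I) : 0 < s := by
  simp only [modParts, Finset.mem_union, Finset.mem_image] at hs
  rcases hs with ⟨i, _, rfl⟩ | ⟨i, _, rfl⟩ <;> omega

theorem mem_modParts {M I i : ℕ} (hM : 5 ≤ M) (hi : i < I)
    (h : (i : ZMod M) = (2 : ℕ) ∨ (i : ZMod M) = -((2 : ℕ) : ZMod M)) :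
    i ∈ modParts M I := by
  have key : ∀ r < M, (i : ZMod M) = (r : ℕ) → ∃ j < I, r + M * j = i := by
    intro r hr h
    rw [ZMod.natCast_eq_natCast_iff', Nat.mod_eq_of_lt hr] at h
    refine ⟨i / M, (Nat.div_le_self _ _).trans_lt hi, ?_⟩
    rw [← h, Nat.mod_add_div]
  simp only [modParts, Finset.mem_union, Finset.mem_image, Finset.mem_range]
  refine h.imp (key 2 (by omega)) fun h => key (M - 2) (by omega) ?_
  rw [h, Nat.cast_sub (by omega), ZMod.natCast_self, zero_sub]

theorem QPart_two_le {d n I : ℕ} (hd : 2 ≤ d) (hn : n < I) :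
    QPart d 2 n ≤ PowerSeries.coeff n (modSeries (d + 3) I) := by
  classical
  rw [modSeries, ← prod_modParts (by omega), QPart, Fintype.card_subtype]
  refine le_trans (Finset.card_le_card ?_)
    (card_partition_parts_mem_le _ (fun s hs => pos_of_mem_modParts (by omega) hs) n)
  intro p
  simp only [Finset.mem_filter, Finset.mem_univ, true_and]
  exact fun h i hi => mem_modParts (by omega)
    (((Multiset.single_le_sum (fun _ _ => Nat.zero_le _) i hi).trans_eq p.parts_sum).trans_lt hn)
    (h i hi)

/-- The generating function of the sums `∑ i < k, (a + d i + M xᵢ)` with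
`x₀ ≤ x₁ ≤ ... ≤ xₖ₋₁`. -/
noncomputable def gapTerm (d M k a : ℕ) : PowerSeries ℕ :=
  PowerSeries.X ^ (a * k + d * k.choose 2) * ∏ i ∈ Finset.range k, geomSeries ((i + 1) * M)

theorem gapTerm_zero (d M a : ℕ) : gapTerm d M 0 a = 1 := by simp [gapTerm]

theorem gapTerm_succ {M : ℕ} (hM : 0 < M) (d k a : ℕ) :
    gapTerm d M (k + 1) a =
      PowerSeries.X ^ a * gapTerm d M k (a + d) + gapTerm d M (k + 1) (a + M) := by
  simp only [gapTerm, Finset.prod_range_succ]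
  rw [Nat.choose_succ_succ' k 1, Nat.choose_one_right]
  have hg := geomSeries_eq (s := (k + 1) * M) (by positivity)
  generalize (∏ i ∈ Finset.range k, geomSeries ((i + 1) * M)) = P
  generalize geomSeries ((k + 1) * M) = g at hg ⊢
  conv_lhs => rw [hg]
  ring

theorem coeff_gapTerm_of_lt {d M k a n : ℕ} (h : n < a) :
    PowerSeries.coeff n (gapTerm d M (k + 1) a) = 0 := by
  rw [gapTerm, PowerSeries.coeff_X_pow_mul', if_neg]
  nlinarith [Nat.zero_le (d * (k + 1).choose 2), Nat.zero_le (a * k)]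

/-- The partitions of `n` into `k` parts, each at least `a`, with all differences at least `d`. -/
def IsGapPartition (d k a : ℕ) {n : ℕ} (p : n.Partition) : Prop :=
  p.parts.card = k ∧ (∀ i ∈ p.parts, a ≤ i) ∧
    ∀ i ∈ p.parts, p.parts.count i = 1 ∧
      ∀ j ∈ p.parts, j ≠ i → (d : ℤ) ≤ |(i : ℤ) - (j : ℤ)|

open Classical in
theorem coeff_gapTerm_le {d : ℕ} (hd : 0 < d) (k : ℕ) :
    ∀ a n : ℕ, 0 < a → PowerSeries.coeff n (gapTerm d 1 k a) ≤
      ((Finset.univ : Finset n.Partition).filter (IsGapPartition d k a)).card := by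
  induction k with
  | zero =>
    intro a n _
    rw [gapTerm_zero, PowerSeries.coeff_one]
    split_ifs with h
    · subst h
      refine Finset.card_pos.2 ⟨default, ?_⟩
      simp [IsGapPartition]
    · exact Nat.zero_le _
  | succ k ih =>
    intro a n ha
    induction hr : n + 1 - a generalizing a with
    | zero => rw [coeff_gapTerm_of_lt (by omega)]; exact Nat.zero_le _
    | succ r ihr =>
      have han : a ≤ n := by omega
      rw [gapTerm_succ one_pos, map_add, PowerSeries.coeff_X_pow_mul', if_pos han]
      rw [← Finset.card_filter_add_card_filter_not (fun p : n.Partition => a ∈ p.parts)]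
      refine add_le_add ((ih (a + d) (n - a) (by omega)).trans ?_)
        ((ihr (a + 1) (by omega) (by omega)).trans (Finset.card_le_card ?_))
      · refine Finset.card_le_card_of_injOn (fun p =>
          { parts := a ::ₘ p.parts
            parts_pos := fun hi => (Multiset.mem_cons.1 hi).elim (fun h => h ▸ ha)
              fun h => p.parts_pos h
            parts_sum := by rw [Multiset.sum_cons, p.parts_sum]; omega }) ?_ ?_
        · intro p
          simp only [Finset.coe_filter, Finset.mem_univ, true_and, Set.mem_ofPred_eq,
            Finset.mem_filter, IsGapPartition, Multiset.card_cons, Multiset.mem_cons]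
          rintro ⟨h1, h2, h3⟩
          have hna : a ∉ p.parts := fun h => by have := h2 a h; omega
          refine ⟨⟨by rw [h1], ?_, ?_⟩, Or.inl trivial⟩
          · rintro i (rfl | hi)
            · exact le_rfl
            · have := h2 i hi; omega
          · rintro i (rfl | hi)
            · refine ⟨by rw [Multiset.count_cons_self, Multiset.count_eq_zero_of_notMem hna], ?_⟩
              rintro j (rfl | hj) hji
              · exact absurd rfl hji
              · have := h2 j hj
                rw [abs_sub_comm]
                exact le_trans (by omega) (le_abs_self _)
            · have hia : i ≠ a := fun h => hna (h ▸ hi)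
              refine ⟨by rw [Multiset.count_cons_of_ne hia]; exact (h3 i hi).1, ?_⟩
              rintro j (rfl | hj) hji
              · have := h2 i hi
                exact le_trans (by omega) (le_abs_self _)
              · exact (h3 i hi).2 j hj hji
        · intro p _ q _ hpq
          simp only [Nat.Partition.mk.injEq, Multiset.cons_inj_right] at hpq
          exact Nat.Partition.ext hpq
      · intro p
        simp only [Finset.mem_filter, Finset.mem_univ, true_and, IsGapPartition]
        rintro ⟨h1, h2, h3⟩
        exact ⟨⟨h1, fun i hi => by have := h2 i hi; omega, h3⟩,
          fun h => by have := h2 a h; omega⟩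

theorem sum_coeff_gapTerm_le_qPart {d a : ℕ} (hd : 0 < d) (ha : 0 < a) (J n : ℕ) :
    ∑ k ∈ Finset.range J, PowerSeries.coeff n (gapTerm d 1 k a) ≤ qPart d a n := by
  classical
  rw [qPart, Fintype.card_subtype]
  refine (Finset.sum_le_sum fun k _ => coeff_gapTerm_le hd k a n ha).trans ?_
  rw [← Finset.card_biUnion]
  · refine Finset.card_le_card fun p => ?_
    simp only [Finset.mem_biUnion, Finset.mem_filter, Finset.mem_univ, true_and]
    rintro ⟨k, _, h⟩
    exact h.2
  · intro k _ l _ hkl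
    rw [Function.onFun, Finset.disjoint_left]
    intro p hp hq
    exact hkl ((Finset.mem_filter.1 hp).2.1.symm.trans (Finset.mem_filter.1 hq).2.1)

theorem add_pow_succ_le_pow_succ_add (r s k : ℕ) :
    (r + s) ^ (k + 1) ≤ r ^ (k + 1) + (k + 1) * s * (r + s) ^ k := by
  induction k with
  | zero => simp
  | succ k ih =>
    calc (r + s) ^ (k + 1 + 1) = r * (r + s) ^ (k + 1) + s * (r + s) ^ (k + 1) := by ring
      _ ≤ r * (r ^ (k + 1) + (k + 1) * s * (r + s) ^ k) + s * (r + s) ^ (k + 1) := by gcongr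
      _ ≤ r * (r ^ (k + 1) + (k + 1) * s * (r + s) ^ k) + s * (r + s) ^ (k + 1) +
          s * ((k + 1) * s * (r + s) ^ k) := Nat.le_add_right _ _
      _ = r ^ (k + 1 + 1) + (k + 1 + 1) * s * (r + s) ^ (k + 1) := by ring

open Nat in
/-- A lower bound for the number of partitions of `m` into parts of size at most `k + 1`. -/
theorem pow_le_coeff_prod_geomSeries (k m : ℕ) :
    m ^ k ≤ PowerSeries.coeff m (∏ i ∈ Finset.range (k + 1), geomSeries ((i + 1) * 1)) *
      ((k + 1)! * k !) := by
  induction k generalizing m with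
  | zero => simp [geomSeries]
  | succ k ih =>
    rw [Finset.prod_range_succ, mul_comm (∏ i ∈ Finset.range (k + 1), _)]
    induction m using Nat.strong_induction_on with
    | _ m ihm =>
      rw [coeff_geomSeries_mul (by omega), add_mul]
      have h1 : (k + 2) * (k + 1) * m ^ k ≤ PowerSeries.coeff m
          (∏ i ∈ Finset.range (k + 1), geomSeries ((i + 1) * 1)) * ((k + 1 + 1)! * (k + 1)!) := by
        refine (Nat.mul_le_mul_left ((k + 2) * (k + 1)) (ih m)).trans_eq ?_
        rw [Nat.factorial_succ (k + 1)]
        nth_rewrite 3 [Nat.factorial_succ k]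
        ring
      split_ifs with h
      · have h2 := ihm (m - (k + 1 + 1) * 1) (by omega)
        obtain ⟨r, rfl⟩ := Nat.exists_eq_add_of_le' h
        rw [Nat.add_sub_cancel] at h2 ⊢
        have h3 := add_pow_succ_le_pow_succ_add r ((k + 1 + 1) * 1) k
        nlinarith
      · have h4 : m ^ (k + 1) ≤ (k + 2) * m ^ k := by
          rw [pow_succ, mul_comm]
          exact Nat.mul_le_mul_right _ (by omega)
        rw [zero_mul, add_zero]
        refine h4.trans (le_trans ?_ h1)
        exact Nat.mul_le_mul_right _ (Nat.le_mul_of_pos_right _ k.succ_pos)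

theorem sum_coeff_geomSeries_mul_le {x C : ℝ} (hx0 : 0 < x) (hx1 : x < 1) {s : ℕ} (hs : 0 < s)
    {f : PowerSeries ℕ}
    (hf : ∀ N, ∑ m ∈ Finset.range N, ((PowerSeries.coeff m f : ℕ) : ℝ) * x ^ m ≤ C) (N : ℕ) :
    ∑ m ∈ Finset.range N, ((PowerSeries.coeff m (geomSeries s * f) : ℕ) : ℝ) * x ^ m ≤
      (1 - x ^ s)⁻¹ * C := by
  have hxs : x ^ s < 1 := pow_lt_one₀ hx0.le hx1 hs.ne'
  have hC : 0 ≤ C := by simpa using hf 0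
  induction N using Nat.strong_induction_on with
  | _ N ih =>
    rcases le_or_gt N s with h | h
    · have h1 : ∀ m ∈ Finset.range N, ((PowerSeries.coeff m (geomSeries s * f) : ℕ) : ℝ) * x ^ m =
          ((PowerSeries.coeff m f : ℕ) : ℝ) * x ^ m := by
        intro m hm
        rw [Finset.mem_range] at hm
        rw [coeff_geomSeries_mul hs, if_neg (by omega), add_zero]
      rw [Finset.sum_congr rfl h1]
      exact (hf N).trans (le_mul_of_one_le_left hC
        ((one_le_inv₀ (by linarith)).2 (by linarith [pow_pos hx0 s])))
    · obtain ⟨r, rfl⟩ := Nat.exists_eq_add_of_le h.le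
      have h1 : ∑ m ∈ Finset.range (s + r),
          ((PowerSeries.coeff m (geomSeries s * f) : ℕ) : ℝ) * x ^ m =
          ∑ m ∈ Finset.range (s + r), ((PowerSeries.coeff m f : ℕ) : ℝ) * x ^ m +
          x ^ s * ∑ m ∈ Finset.range r,
            ((PowerSeries.coeff m (geomSeries s * f) : ℕ) : ℝ) * x ^ m := by
        have h2 : ∀ m, ((PowerSeries.coeff m (geomSeries s * f) : ℕ) : ℝ) * x ^ m =
            ((PowerSeries.coeff m f : ℕ) : ℝ) * x ^ m + if s ≤ m then
              ((PowerSeries.coeff (m - s) (geomSeries s * f) : ℕ) : ℝ) * x ^ m else 0 := by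
          intro m
          rw [coeff_geomSeries_mul hs]
          split_ifs
          · push_cast; ring
          · simp
        rw [Finset.sum_congr rfl fun m _ => h2 m, Finset.sum_add_distrib]
        congr 1
        rw [Finset.sum_range_add, Finset.sum_eq_zero, zero_add, Finset.mul_sum]
        · refine Finset.sum_congr rfl fun m _ => ?_
          rw [if_pos (Nat.le_add_right _ _), Nat.add_sub_cancel_left, pow_add]
          ring
        · intro m hm
          rw [Finset.mem_range] at hm
          rw [if_neg (by omega)]
      rw [h1]
      have h3 := mul_le_mul_of_nonneg_left (ih r (by omega)) (pow_pos hx0 s).le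
      have h4 : (1 - x ^ s)⁻¹ * C = C + x ^ s * ((1 - x ^ s)⁻¹ * C) := by
        have : 1 - x ^ s ≠ 0 := by linarith
        field_simp
        ring
      rw [h4]
      exact add_le_add (hf _) h3

theorem sum_coeff_prod_geomSeries_le {x : ℝ} (hx0 : 0 < x) (hx1 : x < 1) (S : Finset ℕ)
    (hS : ∀ s ∈ S, 0 < s) (N : ℕ) :
    ∑ m ∈ Finset.range N, ((PowerSeries.coeff m (∏ s ∈ S, geomSeries s) : ℕ) : ℝ) * x ^ m ≤
      ∏ s ∈ S, (1 - x ^ s)⁻¹ := by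
  induction S using Finset.induction_on generalizing N with
  | empty =>
    simp only [Finset.prod_empty, PowerSeries.coeff_one, Nat.cast_ite, Nat.cast_one,
      Nat.cast_zero, ite_mul, one_mul, zero_mul]
    rw [Finset.sum_ite_eq' (Finset.range N) 0]
    split_ifs <;> simp
  | insert s S hs ih =>
    rw [Finset.prod_insert hs, Finset.prod_insert hs]
    exact sum_coeff_geomSeries_mul_le hx0 hx1 (hS s (Finset.mem_insert_self _ _))
      (ih fun t ht => hS t (Finset.mem_insert_of_mem ht)) N

theorem coeff_geomSeries_mul_mul_pow_le {x : ℝ} (hx0 : 0 < x) {s : ℕ} (hs : 0 < s)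
    (hx1 : x < 1) (f : PowerSeries ℕ) (n : ℕ) :
    ((PowerSeries.coeff n (geomSeries s * f) : ℕ) : ℝ) * x ^ n ≤
      ∑ m ∈ Finset.range (n + 1), ((PowerSeries.coeff m f : ℕ) : ℝ) * x ^ m := by
  induction n using Nat.strong_induction_on with
  | _ n ih =>
    rw [coeff_geomSeries_mul hs, Finset.sum_range_succ]
    push_cast
    rw [add_mul, add_comm]
    refine add_le_add_left ?_ _
    split_ifs with h
    · calc ((PowerSeries.coeff (n - s) (geomSeries s * f) : ℕ) : ℝ) * x ^ n
          ≤ ((PowerSeries.coeff (n - s) (geomSeries s * f) : ℕ) : ℝ) * x ^ (n - s) :=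
            mul_le_mul_of_nonneg_left
              (pow_le_pow_of_le_one hx0.le hx1.le (Nat.sub_le n s)) (Nat.cast_nonneg _)
        _ ≤ _ := ih (n - s) (by omega)
        _ ≤ _ := Finset.sum_le_sum_of_subset_of_nonneg
            (Finset.range_subset_range.2 (by omega)) fun _ _ _ => by positivity
    · rw [zero_mul]
      exact Finset.sum_nonneg fun _ _ => by positivity

theorem coeff_prod_geomSeries_mul_pow_le {x : ℝ} (hx0 : 0 < x) (hx1 : x < 1) {S : Finset ℕ}
    (hS : ∀ s ∈ S, 0 < s) {s : ℕ} (hs : s ∈ S) (n : ℕ) :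
    ((PowerSeries.coeff n (∏ s ∈ S, geomSeries s) : ℕ) : ℝ) * x ^ n ≤
      (1 - x ^ s) * ∏ s ∈ S, (1 - x ^ s)⁻¹ := by
  rw [← Finset.mul_prod_erase S _ hs, ← Finset.mul_prod_erase S (fun s => (1 - x ^ s)⁻¹) hs,
    ← mul_assoc, mul_inv_cancel₀ (by linarith [pow_lt_one₀ hx0.le hx1 (hS s hs).ne']), one_mul]
  exact (coeff_geomSeries_mul_mul_pow_le hx0 (hS s hs) hx1 _ n).trans
    (sum_coeff_prod_geomSeries_le hx0 hx1 _ (fun t ht => hS t (Finset.mem_of_mem_erase ht)) _)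

open Real in
theorem prod_inv_one_sub_exp_le {S : Finset ℕ} (hS : ∀ s ∈ S, 0 < s) {α κ t : ℝ} (ht : 0 < t)
    (hκ : 0 ≤ κ)
    (h : ∀ u : ℝ, 0 < u → ∑ s ∈ S, exp (-(u * s)) ≤ α / u + κ * u * exp (-(2 * u))) :
    ∏ s ∈ S, (1 - exp (-t) ^ s)⁻¹ ≤ exp (α * π ^ 2 / (6 * t) + κ / 2) := by
  have hlt : ∀ s ∈ S, exp (-t) ^ s < 1 := fun s hs =>
    pow_lt_one₀ (exp_pos _).le (exp_lt_one_iff.2 (by linarith)) (hS s hs).ne'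
  have h1 : HasSum (fun n : ℕ => ∑ s ∈ S, (exp (-t) ^ s) ^ (n + 1) / ((n : ℝ) + 1))
      (∑ s ∈ S, -log (1 - exp (-t) ^ s)) :=
    hasSum_sum fun s hs => hasSum_pow_div_log_of_abs_lt_one
      (by rw [abs_of_nonneg (by positivity)]; exact hlt s hs)
  have hz : HasSum (fun n : ℕ => 1 / ((n : ℝ) + 1) ^ 2) (π ^ 2 / 6) := by
    have := (hasSum_nat_add_iff' 1).2 hasSum_zeta_two
    simpa using this
  have he : exp (-(2 * t)) < 1 := exp_lt_one_iff.2 (by linarith)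
  have hg : HasSum (fun n : ℕ => exp (-(2 * t)) ^ (n + 1))
      (exp (-(2 * t)) * (1 - exp (-(2 * t)))⁻¹) := by
    simpa only [pow_succ'] using (hasSum_geometric_of_lt_one (exp_pos _).le he).mul_left _
  have h2 := (hz.mul_left (α / t)).add (hg.mul_left (κ * t))
  have h3 : ∑ s ∈ S, -log (1 - exp (-t) ^ s) ≤
      α / t * (π ^ 2 / 6) + κ * t * (exp (-(2 * t)) * (1 - exp (-(2 * t)))⁻¹) := by
    refine hasSum_le (fun n => ?_) h1 h2
    have hn : (0 : ℝ) < (n : ℝ) + 1 := by positivity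
    have h4 := h (t * (n + 1)) (by positivity)
    rw [← Finset.sum_div, div_le_iff₀ hn]
    calc ∑ s ∈ S, (exp (-t) ^ s) ^ (n + 1) = ∑ s ∈ S, exp (-(t * (n + 1) * s)) := by
          refine Finset.sum_congr rfl fun s _ => ?_
          rw [← exp_nat_mul, ← exp_nat_mul]
          push_cast
          congr 1
          ring
      _ ≤ _ := h4
      _ = _ := by
          rw [← exp_nat_mul]
          push_cast
          rw [show ((n : ℝ) + 1) * -(2 * t) = -(2 * (t * (n + 1))) by ring]
          field_simp
  have h5 : t * (exp (-(2 * t)) * (1 - exp (-(2 * t)))⁻¹) ≤ 1 / 2 := by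
    have h6 : 2 * t + 1 ≤ exp (2 * t) := add_one_le_exp _
    have h7 : exp (-(2 * t)) * exp (2 * t) = 1 := by rw [← exp_add]; simp
    rw [← mul_assoc, ← div_eq_mul_inv, div_le_iff₀ (by linarith)]
    nlinarith [exp_pos (-(2 * t))]
  rw [← exp_log (Finset.prod_pos fun s hs => inv_pos.2 (sub_pos.2 (hlt s hs))), exp_le_exp,
    log_prod (fun s hs => (inv_pos.2 (sub_pos.2 (hlt s hs))).ne')]
  simp only [log_inv]
  refine h3.trans ?_
  have h8 := mul_le_mul_of_nonneg_left h5 hκ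
  have h9 : α / t * (π ^ 2 / 6) = α * π ^ 2 / (6 * t) := by field_simp
  rw [h9]
  linarith

open Real in
theorem exp_add_exp_div_le {M u : ℝ} (hM : 8 ≤ M) (hu : 0 < u) :
    (exp (-(u * 2)) + exp (-(u * (M - 2)))) * (1 - exp (-(u * M)))⁻¹ ≤
      2 / M / u + (M / 4 - 2 + 8 / M) * u * exp (-(2 * u)) := by
  set v := M * u / 2 with hv
  have hv0 : 0 < v := by positivity
  have hvu : 4 * u ≤ v := by rw [hv]; nlinarith
  have e1 : exp (-(u * (M - 2))) = exp (-(u * 2)) * exp (4 * u - v) * exp (-v) := by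
    rw [← exp_add, ← exp_add]; congr 1; rw [hv]; ring
  have e2 : exp (-(u * M)) = exp (-v) * exp (-v) := by
    rw [← exp_add]; congr 1; rw [hv]; ring
  have e3 : exp (-v) * exp v = 1 := by rw [← exp_add]; simp
  have hsinh : 2 * v ≤ exp v - exp (-v) := by
    have := self_le_sinh_iff.2 hv0.le
    rw [sinh_eq] at this
    linarith
  have q1 : ∀ y : ℝ, 0 ≤ y → exp (-y) ≤ 1 - y + y ^ 2 / 2 := by
    intro y hy
    have h1 := quadratic_le_exp_of_nonneg hy
    have h2 : exp (-y) * exp y = 1 := by rw [← exp_add]; simp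
    have h3 : 0 < 1 + y + y ^ 2 / 2 := by positivity
    have h4 : exp (-y) * (1 + y + y ^ 2 / 2) ≤ 1 := by
      exact (mul_le_mul_of_nonneg_left h1 (exp_pos _).le).trans_eq h2
    have h5 : 1 ≤ (1 - y + y ^ 2 / 2) * (1 + y + y ^ 2 / 2) := by nlinarith [sq_nonneg (y ^ 2)]
    exact le_of_mul_le_mul_right (h4.trans h5) h3
  have q2 := q1 (v - 4 * u) (by linarith)
  have q3 := q1 v hv0.le
  rw [neg_sub] at q2
  have q4 : 1 + 2 * u ≤ exp (2 * u) := by linarith [add_one_le_exp (2 * u)]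
  have e4 : exp (-(u * 2)) * exp (2 * u) = 1 := by rw [← exp_add]; simp [mul_comm]
  have hMu : 2 / M / u = exp (-(u * 2)) * exp (2 * u) / v := by
    rw [e4, hv]; field_simp
  have e5 : exp (-(2 * u)) = exp (-(u * 2)) := by rw [mul_comm]
  rw [e5, hMu, e1, e2]
  set A := exp (-(u * 2)) with hA
  set V := exp (-v) with hV
  set W := exp v with hW
  have hA0 : 0 < A := exp_pos _
  have hV0 : 0 < V := exp_pos _
  have hlt : V < W := by linarith
  have h1V : 1 - V * V = V * (W - V) := by rw [mul_sub, e3]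
  have key : (A + A * exp (4 * u - v) * V) * (1 - V * V)⁻¹ =
      A * (1 + (exp (4 * u - v) + V) / (W - V)) := by
    rw [h1V]
    have : W - V ≠ 0 := by linarith
    field_simp
    linear_combination (-1) * e3
  rw [key]
  have k1 : (exp (4 * u - v) + V) / (W - V) ≤ (exp (4 * u - v) + V) / (2 * v) :=
    div_le_div_of_nonneg_left (by positivity) (by positivity) hsinh
  have k2 : 1 + (exp (4 * u - v) + V) / (2 * v) ≤
      exp (2 * u) / v + (M / 4 - 2 + 8 / M) * u := by
    have hK : (M / 4 - 2 + 8 / M) * u * v = ((v - 4 * u) ^ 2 + v ^ 2) / 4 := by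
      rw [hv]; field_simp; ring
    have : v + (exp (4 * u - v) + V) / 2 ≤ exp (2 * u) + (M / 4 - 2 + 8 / M) * u * v := by
      rw [hK]; linarith
    have h2 : 1 + (exp (4 * u - v) + V) / (2 * v) = (v + (exp (4 * u - v) + V) / 2) / v := by
      field_simp
    have h3 : exp (2 * u) / v + (M / 4 - 2 + 8 / M) * u =
        (exp (2 * u) + (M / 4 - 2 + 8 / M) * u * v) / v := by
      field_simp
    rw [h2, h3]
    exact div_le_div_of_nonneg_right this hv0.le
  calc A * (1 + (exp (4 * u - v) + V) / (W - V))
      ≤ A * (exp (2 * u) / v + (M / 4 - 2 + 8 / M) * u) :=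
        mul_le_mul_of_nonneg_left (by linarith) hA0.le
    _ = _ := by ring

open Real in
theorem sum_modParts_exp_le {M I : ℕ} (hM : 8 ≤ M) {u : ℝ} (hu : 0 < u) :
    ∑ s ∈ modParts M I, exp (-(u * s)) ≤
      2 / M / u + ((M : ℝ) / 4 - 2 + 8 / M) * u * exp (-(2 * u)) := by
  have hM' : (8 : ℝ) ≤ M := by exact_mod_cast hM
  refine le_trans ?_ (exp_add_exp_div_le hM' hu)
  rw [sum_modParts (by omega)]
  have hlt : exp (-(u * M)) < 1 := exp_lt_one_iff.2 (by nlinarith)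
  have hgeo : ∑ i ∈ Finset.range I, exp (-(u * M)) ^ i ≤ (1 - exp (-(u * M)))⁻¹ := by
    rw [← tsum_geometric_of_lt_one (exp_pos _).le hlt]
    exact (summable_geometric_of_lt_one (exp_pos _).le hlt).sum_le_tsum _
      fun _ _ => by positivity
  refine le_trans (le_of_eq ?_) (mul_le_mul_of_nonneg_left hgeo (by positivity))
  rw [add_mul, Finset.mul_sum, Finset.mul_sum]
  congr 1 <;> refine Finset.sum_congr rfl fun i _ => ?_ <;> rw [← exp_nat_mul, ← exp_add]
  · push_cast; congr 1; ring
  · rw [Nat.cast_add, Nat.cast_sub (by omega)]; push_cast; congr 1; ring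

open Real in
theorem coeff_modSeries_le {M I n : ℕ} (hM : 8 ≤ M) (hI : 0 < I) {t : ℝ} (ht : 0 < t) :
    ((PowerSeries.coeff n (modSeries M I) : ℕ) : ℝ) ≤ 2 * t *
      exp (n * t + π ^ 2 / (3 * M * t) + ((M : ℝ) / 4 - 2 + 8 / M) / 2) := by
  have hM' : (8 : ℝ) ≤ M := by exact_mod_cast hM
  have hS : ∀ s ∈ modParts M I, 0 < s := fun s hs => pos_of_mem_modParts (by omega) hs
  have h2 : 2 ∈ modParts M I := Finset.mem_union_left _
    (Finset.mem_image.2 ⟨0, Finset.mem_range.2 hI, by simp⟩)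
  have hx1 : exp (-t) < 1 := exp_lt_one_iff.2 (by linarith)
  have h3 := coeff_prod_geomSeries_mul_pow_le (exp_pos (-t)) hx1 hS h2 n
  have hκ : 0 ≤ (M : ℝ) / 4 - 2 + 8 / M := by
    have : (0 : ℝ) ≤ 8 / M := by positivity
    linarith
  have h4 := prod_inv_one_sub_exp_le hS ht hκ fun u hu => sum_modParts_exp_le hM hu
  have h5 : 1 - exp (-t) ^ 2 ≤ 2 * t := by
    rw [← exp_nat_mul]
    have := add_one_le_exp (((2 : ℕ) : ℝ) * -t)
    push_cast at this ⊢
    linarith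
  rw [prod_modParts (by omega), ← modSeries] at h3
  have hp : 0 ≤ ∏ s ∈ modParts M I, (1 - exp (-t) ^ s)⁻¹ :=
    Finset.prod_nonneg fun s hs => inv_nonneg.2
      (sub_nonneg.2 (pow_le_one₀ (exp_pos _).le hx1.le))
  have h6 := h3.trans (mul_le_mul h5 h4 hp (by positivity))
  have h7 : exp (-t) ^ n * exp (n * t) = 1 := by
    rw [← exp_nat_mul, ← exp_add]; simp
  calc ((PowerSeries.coeff n (modSeries M I) : ℕ) : ℝ)
      = PowerSeries.coeff n (modSeries M I) * exp (-t) ^ n * exp (n * t) := by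
        rw [mul_assoc, h7, mul_one]
    _ ≤ _ := mul_le_mul_of_nonneg_right h6 (exp_pos _).le
    _ = _ := by
        rw [mul_assoc, ← exp_add]
        congr 2
        field_simp
        ring

open Real in
theorem coeff_prod_Icc_geomSeries_le (n N : ℕ) {t : ℝ} (ht : 0 < t) :
    ((PowerSeries.coeff n (∏ s ∈ Finset.Icc 1 N, geomSeries s) : ℕ) : ℝ) ≤
      exp (n * t + π ^ 2 / (6 * t)) := by
  have hS : ∀ s ∈ Finset.Icc 1 N, 0 < s := fun s hs => (Finset.mem_Icc.1 hs).1
  have hx1 : exp (-t) < 1 := exp_lt_one_iff.2 (by linarith)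
  have h3 : ((PowerSeries.coeff n (∏ s ∈ Finset.Icc 1 N, geomSeries s) : ℕ) : ℝ) *
      exp (-t) ^ n ≤ _ :=
    (Finset.single_le_sum (f := fun m =>
      ((PowerSeries.coeff m (∏ s ∈ Finset.Icc 1 N, geomSeries s) : ℕ) : ℝ) * exp (-t) ^ m)
      (fun _ _ => by positivity) (Finset.self_mem_range_succ n)).trans
      (sum_coeff_prod_geomSeries_le (exp_pos (-t)) hx1 _ hS _)
  have h4 := prod_inv_one_sub_exp_le (α := 1) (κ := 0) hS ht le_rfl fun u hu => by
    have hlt : exp (-u) < 1 := exp_lt_one_iff.2 (by linarith)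
    have h5 : ∑ s ∈ Finset.Icc 1 N, exp (-(u * s)) =
        ∑ i ∈ Finset.range N, exp (-u) * exp (-u) ^ i := by
      rw [← Finset.Ico_add_one_right_eq_Icc, Finset.sum_Ico_eq_sum_range, Nat.add_sub_cancel]
      refine Finset.sum_congr rfl fun i _ => ?_
      rw [← exp_nat_mul, ← exp_add]
      push_cast
      congr 1
      ring
    have h6 := (summable_geometric_of_lt_one (exp_pos (-u)).le hlt).sum_le_tsum
      (Finset.range N) fun _ _ => by positivity
    rw [tsum_geometric_of_lt_one (exp_pos _).le hlt] at h6
    rw [h5, ← Finset.mul_sum, zero_mul, zero_mul, add_zero]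
    refine (mul_le_mul_of_nonneg_left h6 (exp_pos _).le).trans ?_
    have h7 : exp (-u) * exp u = 1 := by rw [← exp_add]; simp
    have h8 := add_one_le_exp u
    rw [← div_eq_mul_inv, div_le_div_iff₀ (by linarith) hu]
    nlinarith [exp_pos (-u)]
  have h7 : exp (-t) ^ n * exp (n * t) = 1 := by
    rw [← exp_nat_mul, ← exp_add]; simp
  calc ((PowerSeries.coeff n (∏ s ∈ Finset.Icc 1 N, geomSeries s) : ℕ) : ℝ)
      = (PowerSeries.coeff n (∏ s ∈ Finset.Icc 1 N, geomSeries s) : ℕ) * exp (-t) ^ n *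
        exp (n * t) := by rw [mul_assoc, h7, mul_one]
    _ ≤ exp (1 * π ^ 2 / (6 * t) + 0 / 2) * exp (n * t) :=
        mul_le_mul_of_nonneg_right (h3.trans h4) (exp_pos _).le
    _ = _ := by
        rw [← exp_add]
        congr 1
        ring

open Real in
open scoped Nat in
theorem log_factorial_mul_factorial_le (k : ℕ) :
    log (((k + 1)! * k ! : ℕ) : ℝ) ≤ 2 + 2 * (k + 1) * log (k + 1) - 2 * (k + 1) := by
  have h1 : Stirling.stirlingSeq (k + 1) ≤ Stirling.stirlingSeq 1 :=
    Stirling.stirlingSeq'_antitone k.zero_le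
  have h2 := log_le_log (Stirling.stirlingSeq'_pos k) h1
  have hk : (0 : ℝ) < (k : ℝ) + 1 := by positivity
  rw [Stirling.log_stirlingSeq_formula, Stirling.stirlingSeq_one,
    log_div (exp_pos 1).ne' (by positivity), log_exp, log_sqrt (by norm_num),
    log_div (by positivity) (exp_pos 1).ne', log_exp] at h2
  push_cast at h2
  rw [log_mul two_ne_zero hk.ne'] at h2
  have h3 : log (((k + 1)! : ℕ) : ℝ) = log (k + 1) + log ((k ! : ℕ) : ℝ) := by
    rw [Nat.factorial_succ]
    push_cast
    rw [log_mul hk.ne' (by positivity)]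
  rw [Nat.cast_mul, log_mul (by positivity) (by positivity)]
  linarith

open Real in
open scoped Nat in
theorem exp_le_coeff_gapTerm {d k n : ℕ} {μ y : ℝ} (hd : 4 ≤ d) (hμ : 0 < μ) (hy : 0 ≤ y)
    (hn : (n : ℝ) = (μ + d / 2) * (k + 1) ^ 2 + y) :
    exp (k * (log μ + log (1 + y / (μ * (k + 1) ^ 2))) - 2 * log (k + 1) - 2 + 2 * (k + 1)) ≤
      (PowerSeries.coeff n (gapTerm d 1 (k + 1) 2) : ℕ) := by
  have hd' : (4 : ℝ) ≤ d := by exact_mod_cast hd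
  have hk : (0 : ℝ) < (k : ℝ) + 1 := by positivity
  have hc : ((2 * (k + 1) + d * (k + 1).choose 2 : ℕ) : ℝ) ≤ d / 2 * (k + 1) ^ 2 := by
    push_cast
    rw [Nat.cast_choose_two]
    push_cast
    nlinarith
  have hm : 0 < μ * ((k : ℝ) + 1) ^ 2 + y := by positivity
  have hle : 2 * (k + 1) + d * (k + 1).choose 2 ≤ n := by
    rw [← Nat.cast_le (α := ℝ)]
    linarith
  obtain ⟨m, rfl⟩ := Nat.exists_eq_add_of_le hle
  rw [Nat.cast_add] at hn
  have hmn : μ * ((k : ℝ) + 1) ^ 2 + y ≤ m := by linarith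
  rw [gapTerm, PowerSeries.coeff_X_pow_mul', if_pos hle, Nat.add_sub_cancel_left]
  have h1 := pow_le_coeff_prod_geomSeries k m
  rw [← Nat.cast_le (α := ℝ), Nat.cast_mul, Nat.cast_pow] at h1
  have h2 := log_factorial_mul_factorial_le k
  have h3 : 0 < (((k + 1)! * k ! : ℕ) : ℝ) := by positivity
  rw [← div_le_iff₀ h3] at h1
  refine le_trans ?_ h1
  have hm0 : (0 : ℝ) < m := hm.trans_le hmn
  rw [← le_log_iff_exp_le (by positivity), log_div (by positivity) h3.ne', log_pow]
  have h4 : log μ + 2 * log (k + 1) + log (1 + y / (μ * (k + 1) ^ 2)) ≤ log m := by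
    have h5 : 2 * log ((k : ℝ) + 1) = log (((k : ℝ) + 1) ^ 2) := by rw [log_pow]; norm_num
    rw [h5, ← log_mul hμ.ne' (by positivity), ← log_mul (by positivity) (by positivity)]
    refine log_le_log (by positivity) (le_trans (le_of_eq ?_) hmn)
    field_simp
  have h6 := mul_le_mul_of_nonneg_left h4 (Nat.cast_nonneg (α := ℝ) k)
  linarith

open Real in
theorem modSeries_coeff_le_gapTerm_coeff {d k n I : ℕ} {μ y : ℝ} (hd : 5 ≤ d) (hI : 0 < I)
    (hμ : 0 < μ) (hy : 0 ≤ y) (hn : (n : ℝ) = (μ + d / 2) * (k + 1) ^ 2 + y)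
    (h : log (2 * (k + 1)) + 2 + ((d + 3 : ℝ) / 4 - 2 + 8 / (d + 3)) / 2 +
        (y / (μ * (k + 1) ^ 2) + (k + 1) * (y / (μ * (k + 1) ^ 2)) ^ 2 / 2) ≤
      (k + 1) * (log μ + 1 - d / (2 * μ) - π ^ 2 / 3 * μ / (d + 3))) :
    PowerSeries.coeff n (modSeries (d + 3) I) ≤ PowerSeries.coeff n (gapTerm d 1 (k + 1) 2) := by
  have hk : (0 : ℝ) < (k : ℝ) + 1 := by positivity
  have h1 := exp_le_coeff_gapTerm (by omega) hμ hy hn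
  have ht : 0 < 1 / (μ * ((k : ℝ) + 1)) := by positivity
  have h2 := coeff_modSeries_le (n := n) (show 8 ≤ d + 3 by omega) hI ht
  rw [← Nat.cast_le (α := ℝ)]
  refine h2.trans (le_trans ?_ h1)
  set v := y / (μ * ((k : ℝ) + 1) ^ 2) with hv
  have hv0 : 0 ≤ v := by positivity
  have hyv : y = v * (μ * ((k : ℝ) + 1) ^ 2) := by rw [hv]; field_simp
  rw [← exp_log (by positivity : 0 < 2 * (1 / (μ * ((k : ℝ) + 1)))), ← exp_add, exp_le_exp]
  rw [mul_one_div, log_div two_ne_zero (by positivity), log_mul hμ.ne' hk.ne']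
  rw [log_mul two_ne_zero hk.ne'] at h
  push_cast
  have h3 : (n : ℝ) * (1 / (μ * (k + 1))) = (k + 1) * (1 + d / (2 * μ)) + (k + 1) * v := by
    rw [hn, hyv]; field_simp
  have h4 : π ^ 2 / (3 * ((d : ℝ) + 3) * (1 / (μ * (k + 1)))) =
      (k + 1) * (π ^ 2 / 3 * μ / (d + 3)) := by
    field_simp
  rw [h3, h4]
  have h5 : v - v ^ 2 / 2 ≤ log (1 + v) := by
    refine le_trans ?_ (le_log_one_add_of_nonneg hv0)
    rw [le_div_iff₀ (by positivity)]
    nlinarith [pow_nonneg hv0 3]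
  have h6 := mul_le_mul_of_nonneg_left h5 (Nat.cast_nonneg (α := ℝ) k)
  nlinarith [sq_nonneg v]

open Real in
theorem pi_sq_div_three_le : π ^ 2 / 3 ≤ 3.29 := by
  have := pow_le_pow_left₀ pi_pos.le pi_lt_d4.le 2
  norm_num at this ⊢
  linarith

open Real in
theorem QPart_two_le_qPart_of_le {d K a n : ℕ} {μ g w : ℝ} (hd : 5 ≤ d) (hK : 0 < K) (hμ : 0 < μ)
    (hg : g ≤ log μ) (hw : (μ + d / 2) / μ * (2 + 1 / K) = w)
    (h1 : 2 / 2 ^ a ≤ g + 1 - d / (2 * μ) - 3.29 * μ / (d + 3))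
    (h2 : 2 * K / 2 ^ a - 1 + a * 0.69315 + 2 + ((d + 3 : ℝ) / 4 - 2 + 8 / (d + 3)) / 2 +
        (w + w ^ 2 / 2) / K ≤ K * (g + 1 - d / (2 * μ) - 3.29 * μ / (d + 3)))
    (hn : (μ + d / 2) * K ^ 2 ≤ n) : QPart d 2 n ≤ qPart d 2 n := by
  have hK' : (0 : ℝ) < K := by exact_mod_cast hK
  set l := μ + (d : ℝ) / 2 with hl
  have hl0 : 0 < l := by positivity
  obtain ⟨k, hk⟩ : ∃ k : ℕ, ⌊√(n / l)⌋₊ = k + 1 := by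
    refine Nat.exists_eq_succ_of_ne_zero (Nat.pos_iff_ne_zero.1 (Nat.floor_pos.2 ?_))
    rw [one_le_sqrt, one_le_div hl0]
    exact (le_mul_of_one_le_right hl0.le (one_le_pow₀ (by exact_mod_cast hK))).trans hn
  have hKk : K ≤ k + 1 := by
    rw [← hk, Nat.le_floor_iff (sqrt_nonneg _), le_sqrt' hK', le_div_iff₀ hl0]
    linarith
  have hKk' : (K : ℝ) ≤ k + 1 := by exact_mod_cast hKk
  have hkn : l * (k + 1) ^ 2 ≤ n := by
    have h3 : ((k + 1 : ℕ) : ℝ) ≤ √(n / l) := by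
      rw [← hk]; exact Nat.floor_le (sqrt_nonneg _)
    rw [le_sqrt' (by positivity), le_div_iff₀ hl0] at h3
    push_cast at h3
    linarith
  have hnk : n ≤ l * (k + 2) ^ 2 := by
    have h3 := (Nat.lt_floor_add_one √((n : ℝ) / l)).le
    rw [hk, sqrt_le_left (by positivity), div_le_iff₀ hl0] at h3
    push_cast at h3
    linarith
  have h4 := QPart_two_le (by omega : 2 ≤ d) n.lt_succ_self
  have h5 := sum_coeff_gapTerm_le_qPart (by omega : 0 < d) two_pos (k + 2) n
  refine h4.trans (le_trans ?_ h5)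
  refine le_trans ?_ (Finset.single_le_sum
    (f := fun k => PowerSeries.coeff n (gapTerm d 1 k 2)) (fun _ _ => Nat.zero_le _)
    (Finset.mem_range.2 (Nat.lt_succ_self (k + 1))))
  refine modSeries_coeff_le_gapTerm_coeff hd n.succ_pos hμ
    (sub_nonneg.2 hkn) (add_sub_cancel _ _).symm ?_
  set v := ((n : ℝ) - l * (k + 1) ^ 2) / (μ * (k + 1) ^ 2) with hv
  have hv0 : 0 ≤ v := div_nonneg (sub_nonneg.2 hkn) (by positivity)
  have hw0 : 0 ≤ w := by rw [← hw]; positivity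
  have hvw : v * (k + 1) ≤ w := by
    have h6 : v * (k + 1) ≤ l * (2 * k + 3) / (μ * (k + 1)) := by
      rw [hv, div_mul_eq_mul_div, div_le_div_iff₀ (by positivity) (by positivity)]
      have : (n : ℝ) - l * (k + 1) ^ 2 ≤ l * (2 * k + 3) := by linarith
      have h7 := mul_le_mul_of_nonneg_right this (by positivity : 0 ≤ μ * ((k : ℝ) + 1) ^ 2)
      linarith
    have h8 : l * (2 * k + 3) / (μ * (k + 1)) = l / μ * (2 + 1 / (k + 1)) := by
      field_simp; ring
    rw [← hw]
    refine h6.trans (h8.trans_le ?_)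
    gcongr
  have h9 : v + (k + 1) * v ^ 2 / 2 ≤ (w + w ^ 2 / 2) / K := by
    rw [le_div_iff₀ hK']
    have h10 : v * K ≤ w := (mul_le_mul_of_nonneg_left hKk' hv0).trans hvw
    have h11 : (v * (k + 1)) * (v * K) ≤ w * w := mul_le_mul hvw h10 (by positivity) hw0
    nlinarith
  have h12 : log (2 * (k + 1)) ≤ 2 * (k + 1) / 2 ^ a - 1 + a * 0.69315 := by
    have h13 := log_le_sub_one_of_pos (by positivity : 0 < 2 * ((k : ℝ) + 1) / 2 ^ a)
    rw [log_div (by positivity) (by positivity), log_pow] at h13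
    have h14 : (a : ℝ) * log 2 ≤ a * 0.69315 :=
      mul_le_mul_of_nonneg_left (by linarith [log_two_lt_d9]) (Nat.cast_nonneg a)
    linarith
  have hπ : π ^ 2 / 3 * μ / (d + 3) ≤ 3.29 * μ / (d + 3) := by
    have := pi_sq_div_three_le
    gcongr
  set c := g + 1 - (d : ℝ) / (2 * μ) - 3.29 * μ / (d + 3) with hc
  have h15 : ((k : ℝ) + 1) * c ≤
      (k + 1) * (log μ + 1 - d / (2 * μ) - π ^ 2 / 3 * μ / (d + 3)) :=
    mul_le_mul_of_nonneg_left (by linarith) (by positivity)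
  have h16 : 2 * ((k : ℝ) + 1) / 2 ^ a - 2 * K / 2 ^ a ≤ (k + 1) * c - K * c := by
    have := mul_le_mul_of_nonneg_left h1 (sub_nonneg.2 hKk')
    have h17 : ((k : ℝ) + 1 - K) * (2 / 2 ^ a) =
      2 * ((k : ℝ) + 1) / 2 ^ a - 2 * K / 2 ^ a := by ring
    linarith
  linarith

/-- The last `N` digits of `x` in base `2 ^ w`. -/
def truncDigits (w N x : ℕ) : ℕ := x &&& (2 ^ (w * N) - 1)

/-- The number whose base `2 ^ w` digits are the first coefficients of `geomSeries s`. -/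
def geomDigits (w N s : ℕ) : ℕ := (2 ^ (w * s * (N / s + 1)) - 1) / (2 ^ (w * s) - 1)

/-- `x` is congruent modulo `2 ^ (w * N)` to the value at `2 ^ w` of the truncation of `f`
at order `N`. -/
def HasDigits (w N x : ℕ) (f : PowerSeries ℕ) : Prop :=
  ∃ p : Polynomial ℕ, (∀ n < N, p.coeff n = PowerSeries.coeff n f) ∧
    x ≡ p.eval (2 ^ w) [MOD 2 ^ (w * N)]

theorem HasDigits.mul {w N x y : ℕ} {f g : PowerSeries ℕ} (hf : HasDigits w N x f)
    (hg : HasDigits w N y g) : HasDigits w N (x * y) (f * g) := by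
  obtain ⟨p, hp, hx⟩ := hf
  obtain ⟨q, hq, hy⟩ := hg
  refine ⟨p * q, fun n hn => ?_, by rw [Polynomial.eval_mul]; exact hx.mul hy⟩
  rw [Polynomial.coeff_mul, PowerSeries.coeff_mul]
  refine Finset.sum_congr rfl fun ij hij => ?_
  rw [Finset.HasAntidiagonal.mem_antidiagonal] at hij
  rw [hp _ (by omega), hq _ (by omega)]

theorem truncDigits_eq_mod (w N x : ℕ) : truncDigits w N x = x % 2 ^ (w * N) :=
  Nat.and_two_pow_sub_one_eq_mod x _

theorem HasDigits.trunc {w N x : ℕ} {f : PowerSeries ℕ} (hf : HasDigits w N x f) :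
    HasDigits w N (truncDigits w N x) f := by
  obtain ⟨p, hp, hx⟩ := hf
  exact ⟨p, hp, by rw [truncDigits_eq_mod]; exact (Nat.mod_modEq _ _).trans hx⟩

theorem HasDigits.congr {w N x : ℕ} {f g : PowerSeries ℕ} (hf : HasDigits w N x f)
    (h : ∀ n < N, PowerSeries.coeff n f = PowerSeries.coeff n g) : HasDigits w N x g := by
  obtain ⟨p, hp, hx⟩ := hf
  exact ⟨p, fun n hn => (hp n hn).trans (h n hn), hx⟩

theorem hasDigits_one (w N : ℕ) : HasDigits w N 1 1 :=
  ⟨1, fun n _ => by rw [Polynomial.coeff_one, PowerSeries.coeff_one], by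
    rw [Polynomial.eval_one]⟩

theorem HasDigits.one_add_X_pow_mul {w N a x : ℕ} {f : PowerSeries ℕ}
    (hf : HasDigits w (N - a) x f) :
    HasDigits w N (1 + x <<< (w * a)) (1 + PowerSeries.X ^ a * f) := by
  obtain ⟨p, hp, hx⟩ := hf
  refine ⟨1 + Polynomial.X ^ a * p, fun n hn => ?_, ?_⟩
  · rw [Polynomial.coeff_add, Polynomial.coeff_one, Polynomial.coeff_X_pow_mul', map_add,
      PowerSeries.coeff_one, PowerSeries.coeff_X_pow_mul']
    congr 1
    split_ifs with h
    · exact hp _ (by omega)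
    · rfl
  · rw [Polynomial.eval_add, Polynomial.eval_one, Polynomial.eval_mul, Polynomial.eval_pow,
      Polynomial.eval_X, ← pow_mul, Nat.shiftLeft_eq, mul_comm x]
    refine Nat.ModEq.add_left 1 ?_
    rcases le_or_gt a N with h | h
    · have := Nat.ModEq.mul_left' (2 ^ (w * a)) hx
      rwa [← pow_add, ← mul_add, Nat.add_sub_cancel' h] at this
    · have h1 : 2 ^ (w * N) ∣ 2 ^ (w * a) := pow_dvd_pow _ (Nat.mul_le_mul_left _ h.le)
      exact ((Nat.modEq_zero_iff_dvd.2 (h1.mul_right _)).trans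
        (Nat.modEq_zero_iff_dvd.2 (h1.mul_right _)).symm)

theorem geomDigits_eq {w s : ℕ} (hw : 0 < w) (hs : 0 < s) (N : ℕ) :
    geomDigits w N s = ∑ i ∈ Finset.range (N / s + 1), (2 ^ (w * s)) ^ i := by
  rw [geomDigits, pow_mul, Nat.geomSum_eq]
  exact Nat.le_self_pow (Nat.mul_pos hw hs).ne' 2

theorem hasDigits_geomDigits {w s : ℕ} (hw : 0 < w) (hs : 0 < s) (N : ℕ) :
    HasDigits w N (geomDigits w N s) (geomSeries s) := by
  refine ⟨∑ i ∈ Finset.range (N / s + 1), Polynomial.X ^ (s * i), fun n hn => ?_, ?_⟩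
  · rw [Polynomial.finsetSum_coeff, geomSeries, PowerSeries.coeff_mk]
    simp only [Polynomial.coeff_X_pow]
    split_ifs with h
    · obtain ⟨m, rfl⟩ := h
      rw [Finset.sum_eq_single m, if_pos rfl]
      · exact fun i _ him => if_neg fun h => him (Nat.eq_of_mul_eq_mul_left hs h).symm
      · intro hm
        rw [Finset.mem_range, not_lt, Nat.succ_le_iff, Nat.div_lt_iff_lt_mul hs, mul_comm] at hm
        omega
    · exact Finset.sum_eq_zero fun i _ => if_neg fun hi => h ⟨i, hi⟩
  · rw [geomDigits_eq hw hs, Polynomial.eval_finsetSum]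
    simp only [Polynomial.eval_pow, Polynomial.eval_X, pow_mul]
    rfl

/-- The sum of `X ^ (a k + d k (k - 1) / 2) * ∏ j < k, geomSeries ((i + j) * M)` over `k ≤ J`. -/
noncomputable def hornerSeries (d M : ℕ) : ℕ → ℕ → ℕ → PowerSeries ℕ
  | 0, _, _ => 1
  | J + 1, i, a => 1 + PowerSeries.X ^ a * (geomSeries (i * M) * hornerSeries d M J (i + 1) (a + d))

/-- The first `N` coefficients of `hornerSeries d M J i a`, as digits in base `2 ^ w`. -/
def hornerDigits (w d M : ℕ) : ℕ → ℕ → ℕ → ℕ → ℕ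
  | 0, _, _, _ => 1
  | J + 1, i, N, a => 1 + truncDigits w (N - a)
      (geomDigits w (N - a) (i * M) * hornerDigits w d M J (i + 1) (N - a) (a + d)) <<< (w * a)

theorem hasDigits_hornerDigits {w M : ℕ} (hw : 0 < w) (hM : 0 < M) (d J : ℕ) :
    ∀ i N a : ℕ, 0 < i → HasDigits w N (hornerDigits w d M J i N a) (hornerSeries d M J i a) := by
  induction J with
  | zero => exact fun _ _ _ _ => hasDigits_one _ _
  | succ J ih =>
    intro i N a hi
    exact ((hasDigits_geomDigits hw (Nat.mul_pos hi hM) _).mul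
      (ih _ _ _ i.succ_pos)).trunc.one_add_X_pow_mul

theorem hornerSeries_eq_sum (d M J : ℕ) : ∀ i a : ℕ, hornerSeries d M J i a =
    ∑ k ∈ Finset.range (J + 1), PowerSeries.X ^ (a * k + d * k.choose 2) *
      ∏ j ∈ Finset.range k, geomSeries ((i + j) * M) := by
  induction J with
  | zero => intro i a; simp [hornerSeries]
  | succ J ih =>
    intro i a
    rw [hornerSeries, ih, Finset.sum_range_succ' _ (J + 1), Finset.mul_sum, Finset.mul_sum,
      add_comm]
    congr 1
    · refine Finset.sum_congr rfl fun k _ => ?_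
      rw [Finset.prod_range_succ', Nat.choose_succ_succ' k 1, Nat.choose_one_right, add_zero]
      simp only [add_assoc, add_comm 1]
      ring
    · simp

theorem hornerSeries_one (d M J a : ℕ) :
    hornerSeries d M J 1 a = ∑ k ∈ Finset.range (J + 1), gapTerm d M k a := by
  rw [hornerSeries_eq_sum]
  simp only [gapTerm, add_comm 1]

theorem coeff_prod_geomSeries_eq {M : ℕ} (hM : 0 < M) (I : ℕ) : ∀ J a n : ℕ, n < a * (J + 1) →
    n < a + M * I → PowerSeries.coeff n (∏ i ∈ Finset.range I, geomSeries (a + M * i)) =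
      PowerSeries.coeff n (∑ k ∈ Finset.range (J + 1), gapTerm 0 M k a) := by
  have hlt : ∀ J a n : ℕ, n < a →
      PowerSeries.coeff n (∑ k ∈ Finset.range (J + 1), gapTerm 0 M k a) =
        PowerSeries.coeff n (1 : PowerSeries ℕ) := by
    intro J a n h
    rw [Finset.sum_range_succ', gapTerm_zero, map_add, map_sum,
      Finset.sum_eq_zero fun k _ => coeff_gapTerm_of_lt h, zero_add]
  induction I with
  | zero =>
    intro J a n _ h2
    rw [hlt _ _ _ (by omega), Finset.prod_range_zero]
  | succ I ih =>
    intro J a n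
    induction n using Nat.strong_induction_on generalizing J with
    | _ n ihn =>
      intro h1 h2
      have ha : 0 < a := Nat.pos_of_ne_zero (by rintro rfl; omega)
      have hP : ∏ i ∈ Finset.range (I + 1), geomSeries (a + M * i) =
          geomSeries a * ∏ i ∈ Finset.range I, geomSeries (a + M + M * i) := by
        rw [Finset.prod_range_succ', mul_comm, mul_zero, add_zero]
        congr 1
        exact Finset.prod_congr rfl fun i _ => by congr 1; ring
      rw [hP, coeff_geomSeries_mul ha, ih J (a + M) n (h1.trans_le (by gcongr; omega)) (by
        rw [mul_add] at h2; omega), ← hP]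
      split_ifs with h
      · obtain ⟨J, rfl⟩ : ∃ J', J = J' + 1 := Nat.exists_eq_succ_of_ne_zero (by
          rintro rfl; omega)
        rw [ihn (n - a) (by omega) J (by rw [mul_add] at h1; omega) (by omega),
          Finset.sum_range_succ' _ (J + 1), Finset.sum_range_succ' _ (J + 1)]
        simp only [gapTerm_succ hM 0 _ a, gapTerm_zero, add_zero, Finset.sum_add_distrib,
          ← Finset.mul_sum, map_add]
        rw [PowerSeries.coeff_X_pow_mul', if_pos h]
        ring
      · rw [hlt _ _ _ (by omega), hlt _ _ _ (by omega), add_zero]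

/-- The first `N` coefficients of the product of `f` and `geomSeries (a + M * i)`, `i < r`, as
digits in base `2 ^ w`. -/
def prodDigits (w N a M f : ℕ) : ℕ → ℕ
  | 0 => f
  | r + 1 => truncDigits w N (geomDigits w N (a + M * r) * prodDigits w N a M f r)

theorem hasDigits_prodDigits {w N a x : ℕ} (hw : 0 < w) (ha : 0 < a) (M : ℕ) {f : PowerSeries ℕ}
    (hf : HasDigits w N x f) (r : ℕ) : HasDigits w N (prodDigits w N a M x r)
      ((∏ i ∈ Finset.range r, geomSeries (a + M * i)) * f) := by
  induction r with
  | zero => rwa [Finset.prod_range_zero, one_mul]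
  | succ r ih =>
    rw [Finset.prod_range_succ, mul_comm (∏ i ∈ Finset.range r, _), mul_assoc]
    exact ((hasDigits_geomDigits hw (by omega) N).mul ih).trunc

/-- The first `N` coefficients of `modSeries M (r + N)`, as digits in base `2 ^ w`. -/
def modDigits (w N M r : ℕ) : ℕ :=
  prodDigits w N 2 M (prodDigits w N (M - 2) M (truncDigits w N
    (hornerDigits w 0 M (N / (2 + M * r)) 1 N (2 + M * r) *
      hornerDigits w 0 M (N / (M - 2 + M * r)) 1 N (M - 2 + M * r))) r) r

theorem hasDigits_modDigits {w M : ℕ} (hw : 0 < w) (hM : 3 ≤ M) (N r : ℕ) :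
    HasDigits w N (modDigits w N M r) (modSeries M (r + N)) := by
  have key : ∀ a, 0 < a → HasDigits w N (hornerDigits w 0 M (N / a) 1 N a)
      (∏ i ∈ Finset.range N, geomSeries (a + M * i)) := by
    intro a ha
    refine (hasDigits_hornerDigits hw (by omega) _ _ _ _ _ one_pos).congr fun n hn => ?_
    rw [hornerSeries_one, coeff_prod_geomSeries_eq (by omega)]
    · exact hn.trans (Nat.lt_mul_div_succ N ha)
    · nlinarith
  have h := hasDigits_prodDigits hw two_pos M (hasDigits_prodDigits hw (by omega : 0 < M - 2) M
    ((key (2 + M * r) (by omega)).mul (key (M - 2 + M * r) (by omega))).trunc r) r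
  refine (congrArg (HasDigits w N _) ?_).mp h
  rw [modSeries, Finset.prod_range_add, Finset.prod_range_add]
  simp only [mul_add, add_assoc]
  ring

theorem HasDigits.truncDigits_eq {w N x : ℕ} {f : PowerSeries ℕ}
    (hf : HasDigits w N x f) (hlt : ∀ n < N, PowerSeries.coeff n f < 2 ^ w) :
    truncDigits w N x = ∑ n ∈ Finset.range N, PowerSeries.coeff n f * (2 ^ w) ^ n := by
  obtain ⟨p, hp, hx⟩ := hf
  have h1 : p.eval (2 ^ w) ≡ ∑ n ∈ Finset.range N, PowerSeries.coeff n f * (2 ^ w) ^ n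
      [MOD 2 ^ (w * N)] := by
    rw [Polynomial.eval_eq_sum_range' (n := N + (p.natDegree + 1)) (by omega),
      Finset.sum_range_add]
    have h2 : ∀ n ∈ Finset.range N, p.coeff n * (2 ^ w) ^ n =
        PowerSeries.coeff n f * (2 ^ w) ^ n := fun n hn => by rw [hp n (Finset.mem_range.1 hn)]
    rw [Finset.sum_congr rfl h2]
    conv_rhs => rw [← add_zero (∑ n ∈ Finset.range N, _)]
    refine Nat.ModEq.add_left _ (Nat.modEq_zero_iff_dvd.2 (Finset.dvd_sum fun n _ => ?_))
    rw [pow_add, ← pow_mul]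
    exact ((dvd_mul_right _ _).mul_left _)
  rw [truncDigits_eq_mod, hx.trans h1]
  refine Nat.mod_eq_of_lt ?_
  clear hp hx h1
  induction N with
  | zero => simp
  | succ N ih =>
    rw [Finset.sum_range_succ, ← pow_mul, mul_add, mul_one, pow_add]
    have h2 := ih fun n hn => hlt n (by omega)
    have h3 := Nat.mul_le_mul_right (2 ^ (w * N)) (hlt N N.lt_succ_self)
    rw [Nat.succ_mul] at h3
    linarith

theorem testBit_sum_mul_two_pow {w j : ℕ} (hj : j < w) (N : ℕ) : ∀ (f : ℕ → ℕ) (n : ℕ), n < N →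
    (∀ i < N, f i < 2 ^ w) →
    (∑ i ∈ Finset.range N, f i * (2 ^ w) ^ i).testBit (w * n + j) = (f n).testBit j := by
  induction N with
  | zero => exact fun _ _ hn => absurd hn (Nat.not_lt_zero _)
  | succ N ih =>
    intro f n hn hf
    have h1 : ∑ i ∈ Finset.range (N + 1), f i * (2 ^ w) ^ i =
        2 ^ w * ∑ i ∈ Finset.range N, f (i + 1) * (2 ^ w) ^ i + f 0 := by
      rw [Finset.sum_range_succ', Finset.mul_sum, pow_zero, mul_one]
      congr 1
      exact Finset.sum_congr rfl fun i _ => by ring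
    rw [h1, Nat.testBit_two_pow_mul_add _ (hf 0 N.succ_pos)]
    cases n with
    | zero => rw [if_pos (by omega), mul_zero, zero_add]
    | succ n =>
      rw [if_neg (by rw [mul_add]; omega), ← ih (fun i => f (i + 1)) n (by omega)
        fun i hi => hf _ (by omega)]
      congr 1
      rw [mul_add]; omega

/-- A comparison of the first `N` coefficients of `hornerSeries d 1 J 1 2` and of
`modSeries (d + 3) (r + N)`, performed on packed digits in base `2 ^ w`. -/
def compareDigits (w N d r J : ℕ) : Bool :=
  Nat.beq ((truncDigits w N (hornerDigits w d 1 J 1 N 2) + 2 ^ (w - 1) * geomDigits w (N - 1) 1 -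
    truncDigits w N (modDigits w N (d + 3) r)) &&& 2 ^ (w - 1) * geomDigits w (N - 1) 1)
    (2 ^ (w - 1) * geomDigits w (N - 1) 1)

theorem coeff_modSeries_le_of_compareDigits {w N d r J : ℕ} (hw : 0 < w)
    (ha : ∀ n < N, PowerSeries.coeff n (modSeries (d + 3) (r + N)) < 2 ^ (w - 1))
    (hb : ∀ n < N, PowerSeries.coeff n (hornerSeries d 1 J 1 2) < 2 ^ (w - 1))
    (h : compareDigits w N d r J = true) {n : ℕ} (hn : n < N) :
    PowerSeries.coeff n (modSeries (d + 3) (r + N)) ≤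
      PowerSeries.coeff n (hornerSeries d 1 J 1 2) := by
  have h2w : 2 ^ w = 2 ^ (w - 1) + 2 ^ (w - 1) := by
    rw [← two_mul, ← pow_succ', Nat.sub_add_cancel hw]
  have hlt : 2 ^ (w - 1) < 2 ^ w := h2w ▸ Nat.lt_add_of_pos_left (Nat.two_pow_pos _)
  have hH : 2 ^ (w - 1) * geomDigits w (N - 1) 1 =
      ∑ i ∈ Finset.range N, 2 ^ (w - 1) * (2 ^ w) ^ i := by
    rw [geomDigits_eq hw one_pos, Finset.mul_sum, mul_one, Nat.div_one,
      Nat.sub_add_cancel (by omega)]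
  rw [compareDigits, Nat.beq_eq, hH,
    (hasDigits_hornerDigits hw one_pos d J 1 N 2 one_pos).truncDigits_eq
      fun n hn => (hb n hn).trans hlt,
    (hasDigits_modDigits hw (by omega) N r).truncDigits_eq
      fun n hn => (ha n hn).trans hlt] at h
  have hS : ∑ i ∈ Finset.range N, PowerSeries.coeff i (hornerSeries d 1 J 1 2) * (2 ^ w) ^ i +
      ∑ i ∈ Finset.range N, 2 ^ (w - 1) * (2 ^ w) ^ i -
      ∑ i ∈ Finset.range N, PowerSeries.coeff i (modSeries (d + 3) (r + N)) * (2 ^ w) ^ i =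
      ∑ i ∈ Finset.range N, (PowerSeries.coeff i (hornerSeries d 1 J 1 2) + 2 ^ (w - 1) -
        PowerSeries.coeff i (modSeries (d + 3) (r + N))) * (2 ^ w) ^ i := by
    rw [Nat.sub_eq_iff_eq_add, ← Finset.sum_add_distrib, ← Finset.sum_add_distrib]
    · refine Finset.sum_congr rfl fun i hi => ?_
      have := ha i (Finset.mem_range.1 hi)
      rw [← add_mul, ← add_mul, Nat.sub_add_cancel (by omega)]
    · refine le_add_left (Finset.sum_le_sum fun i hi => ?_)
      exact Nat.mul_le_mul_right _ (ha i (Finset.mem_range.1 hi)).le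
  rw [hS] at h
  have h1 := congrArg (fun x => x.testBit (w * n + (w - 1))) h
  simp only [Nat.testBit_and] at h1
  rw [testBit_sum_mul_two_pow (by omega) N (fun _ => 2 ^ (w - 1)) n hn fun _ _ => by
      have := Nat.two_pow_pos (w - 1); omega,
    testBit_sum_mul_two_pow (by omega) N (fun i => PowerSeries.coeff i (hornerSeries d 1 J 1 2) +
      2 ^ (w - 1) - PowerSeries.coeff i (modSeries (d + 3) (r + N))) n hn fun i hi => by
        have := hb i hi; omega,
    Nat.testBit_two_pow_self, Bool.and_true] at h1
  have h2 := Nat.ge_two_pow_of_testBit h1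
  have := ha n hn
  omega

open Real in
theorem QPart_two_le_qPart_of_compareDigits {w N d r J ρ : ℕ} (hd : 6 ≤ d) (hρ : 2 ≤ ρ)
    (hM : d + 3 ≤ 9 * ρ) (hw : 10000 * N + 16450 * ρ ^ 2 ≤ 6931 * w * ρ)
    (h : compareDigits (w + 1) N d r J = true) {n : ℕ} (hn : n < N) :
    QPart d 2 n ≤ qPart d 2 n := by
  have hρ0 : (0 : ℝ) < ρ := by positivity
  have hρ' : (2 : ℝ) ≤ ρ := by exact_mod_cast hρ
  have ht : (0 : ℝ) < 1 / ρ := by positivity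
  have hπ := pi_sq_div_three_le
  have hexp : ∀ x n : ℕ, n < N → ∀ E : ℝ, (x : ℝ) ≤ exp (n * (1 / ρ) + E) → E ≤ 1.645 * ρ →
      x < 2 ^ w := by
    intro x n hn E hx hE
    rw [← Nat.cast_lt (α := ℝ), Nat.cast_pow, Nat.cast_ofNat]
    refine hx.trans_lt ?_
    rw [← lt_log_iff_exp_lt (by positivity), log_pow]
    have hn' : (n : ℝ) < N := by exact_mod_cast hn
    have hw' : (10000 : ℝ) * N + 16450 * ρ ^ 2 ≤ 6931 * w * ρ := by exact_mod_cast hw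
    have h1 : (n : ℝ) * (1 / ρ) < N / ρ := by
      rw [mul_one_div]; exact div_lt_div_of_pos_right hn' hρ0
    have h2 : (N : ℝ) / ρ ≤ 0.6931 * w - 1.645 * ρ := by
      rw [div_le_iff₀ hρ0]; nlinarith
    have h3 : 0.6931 * (w : ℝ) ≤ w * log 2 := by
      rw [mul_comm]
      exact mul_le_mul_of_nonneg_left (by linarith [log_two_gt_d9]) (Nat.cast_nonneg w)
    linarith
  have hN : n < r + N := by omega
  have hq : ∀ n, PowerSeries.coeff n (hornerSeries d 1 J 1 2) ≤ qPart d 2 n := fun n => by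
    rw [hornerSeries_one, map_sum]
    exact sum_coeff_gapTerm_le_qPart (by omega) two_pos (J + 1) n
  refine ((QPart_two_le (by omega) hN).trans
    (coeff_modSeries_le_of_compareDigits w.succ_pos ?_ ?_ h hn)).trans (hq n)
  · intro n hn
    have hM9 : (9 : ℝ) ≤ ((d + 3 : ℕ) : ℝ) := by exact_mod_cast (by omega : 9 ≤ d + 3)
    have hMρ : ((d + 3 : ℕ) : ℝ) ≤ 9 * ρ := by exact_mod_cast hM
    have h1 := coeff_modSeries_le (n := n) (by omega : 8 ≤ d + 3) (by omega : 0 < r + N) ht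
    generalize ((d + 3 : ℕ) : ℝ) = M at h1 hM9 hMρ
    have h2 : 2 * (1 / (ρ : ℝ)) ≤ 1 := by rw [mul_one_div, div_le_one hρ0]; exact hρ'
    rw [add_assoc] at h1
    refine hexp _ n hn _ (h1.trans (mul_le_of_le_one_left (exp_pos _).le h2)) ?_
    have h3 : π ^ 2 / (3 * M * (1 / ρ)) = π ^ 2 / 3 * ρ / M := by field_simp
    have h4 : π ^ 2 / 3 * ρ / M ≤ 3.29 * ρ / 9 := by gcongr
    have h5 : 8 / M ≤ 1 := by rw [div_le_one (by linarith)]; linarith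
    rw [h3]
    linarith
  · intro n hn
    have h1 : PowerSeries.coeff n (hornerSeries d 1 J 1 2) ≤
        PowerSeries.coeff n (∏ s ∈ Finset.Icc 1 n, geomSeries s) := by
      refine (hq n).trans (le_trans ?_ (card_partition_parts_mem_le (Finset.Icc 1 n)
        (fun s hs => (Finset.mem_Icc.1 hs).1) n))
      rw [qPart, Fintype.card_subtype]
      refine Finset.card_le_card fun p hp => ?_
      rw [Finset.mem_filter]
      exact ⟨Finset.mem_univ _, fun i hi => Finset.mem_Icc.2 ⟨p.parts_pos hi,
        (Multiset.single_le_sum (fun _ _ => Nat.zero_le _) i hi).trans_eq p.parts_sum⟩⟩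
    refine hexp _ n hn _ ((Nat.cast_le.2 h1).trans (coeff_prod_Icc_geomSeries_le n n ht)) ?_
    have h3 : π ^ 2 / (6 * (1 / (ρ : ℝ))) = π ^ 2 / 3 * ρ / 2 := by field_simp; ring
    rw [h3]
    nlinarith

open Real in
theorem QPart_two_le_qPart_of_bounds {d : ℕ} (i j K a w N r J ρ : ℕ) {μ g w' : ℝ} (hd : 6 ≤ d)
    (hK : 0 < K) (hμ : 2 ^ i * 3 ^ j / 2 = μ) (hg : 0.6931 * i + 1.0974 * j - 0.69315 = g)
    (hw' : (μ + d / 2) / μ * (2 + 1 / K) = w')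
    (h1 : 2 / 2 ^ a ≤ g + 1 - d / (2 * μ) - 3.29 * μ / (d + 3))
    (h2 : 2 * K / 2 ^ a - 1 + a * 0.69315 + 2 + ((d + 3 : ℝ) / 4 - 2 + 8 / (d + 3)) / 2 +
        (w' + w' ^ 2 / 2) / K ≤ K * (g + 1 - d / (2 * μ) - 3.29 * μ / (d + 3)))
    (hN : (μ + d / 2) * K ^ 2 ≤ N) (hρ : 2 ≤ ρ) (hM : d + 3 ≤ 9 * ρ)
    (hw : 10000 * N + 16450 * ρ ^ 2 ≤ 6931 * w * ρ)
    (h : compareDigits (w + 1) N d r J = true) (n : ℕ) : QPart d 2 n ≤ qPart d 2 n := by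
  rcases lt_or_ge n N with hn | hn
  · exact QPart_two_le_qPart_of_compareDigits hd hρ hM hw h hn
  have hlog : g ≤ log μ := by
    have h3 : (19 : ℝ) * log 2 ≤ 12 * log 3 := by
      have := log_le_log (by norm_num) (by norm_num : (2 : ℝ) ^ 19 ≤ 3 ^ 12)
      rw [log_pow, log_pow] at this
      exact_mod_cast this
    rw [← hμ, ← hg, log_div (by positivity) two_ne_zero, log_mul (by positivity) (by positivity),
      log_pow, log_pow]
    have h4 := mul_le_mul_of_nonneg_left log_two_gt_d9.le (Nat.cast_nonneg (α := ℝ) i)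
    have h5 := mul_le_mul_of_nonneg_left (by linarith [log_two_gt_d9] : 1.0974 ≤ log 3)
      (Nat.cast_nonneg (α := ℝ) j)
    have h6 := log_two_lt_d9
    have h7 : (0 : ℝ) ≤ i := Nat.cast_nonneg i
    linarith
  exact QPart_two_le_qPart_of_le (by omega) hK (by rw [← hμ]; positivity) hlog hw' h1 h2
    (hN.trans (by exact_mod_cast hn))

theorem QPart_two_le_qPart_six (n : ℕ) : QPart 6 2 n ≤ qPart 6 2 n :=
  QPart_two_le_qPart_of_bounds 0 2 38 6 386 10830 35 60 76 (by norm_num) (by norm_num)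
    rfl rfl rfl (by norm_num) (by norm_num) (by norm_num) (by norm_num) (by norm_num)
    (by norm_num) (by decide +kernel) n

theorem QPart_two_le_qPart_eight (n : ℕ) : QPart 8 2 n ≤ qPart 8 2 n :=
  QPart_two_le_qPart_of_bounds 2 1 22 5 258 4840 21 35 51 (by norm_num) (by norm_num)
    rfl rfl rfl (by norm_num) (by norm_num) (by norm_num) (by norm_num) (by norm_num)
    (by norm_num) (by decide +kernel) n

theorem QPart_two_le_qPart_ten (n : ℕ) : QPart 10 2 n ≤ qPart 10 2 n :=
  QPart_two_le_qPart_of_bounds 2 1 17 5 209 3179 16 25 42 (by norm_num) (by norm_num)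
    rfl rfl rfl (by norm_num) (by norm_num) (by norm_num) (by norm_num) (by norm_num)
    (by norm_num) (by decide +kernel) n

theorem QPart_two_le_qPart_twelve (n : ℕ) : QPart 12 2 n ≤ qPart 12 2 n :=
  QPart_two_le_qPart_of_bounds 4 0 13 5 181 2366 13 20 35 (by norm_num) (by norm_num)
    rfl rfl rfl (by norm_num) (by norm_num) (by norm_num) (by norm_num) (by norm_num)
    (by norm_num) (by decide +kernel) n

theorem QPart_two_le_qPart_fourteen (n : ℕ) : QPart 14 2 n ≤ qPart 14 2 n :=
  QPart_two_le_qPart_of_bounds 4 0 12 5 173 2160 11 17 33 (by norm_num) (by norm_num)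
    rfl rfl rfl (by norm_num) (by norm_num) (by norm_num) (by norm_num) (by norm_num)
    (by norm_num) (by decide +kernel) n

theorem QPart_two_le_qPart_sixteen (n : ℕ) : QPart 16 2 n ≤ qPart 16 2 n :=
  QPart_two_le_qPart_of_bounds 4 0 12 5 178 2304 11 17 36 (by norm_num) (by norm_num)
    rfl rfl rfl (by norm_num) (by norm_num) (by norm_num) (by norm_num) (by norm_num)
    (by norm_num) (by decide +kernel) n

theorem QPart_two_le_qPart_eighteen (n : ℕ) : QPart 18 2 n ≤ qPart 18 2 n :=
  QPart_two_le_qPart_of_bounds 3 1 10 4 170 2100 10 15 34 (by norm_num) (by norm_num)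
    rfl rfl rfl (by norm_num) (by norm_num) (by norm_num) (by norm_num) (by norm_num)
    (by norm_num) (by decide +kernel) n

theorem QPart_two_le_qPart_twenty (n : ℕ) : QPart 20 2 n ≤ qPart 20 2 n :=
  QPart_two_le_qPart_of_bounds 3 1 9 4 157 1782 9 13 30 (by norm_num) (by norm_num)
    rfl rfl rfl (by norm_num) (by norm_num) (by norm_num) (by norm_num) (by norm_num)
    (by norm_num) (by decide +kernel) n

theorem QPart_two_le_qPart_twenty_two (n : ℕ) : QPart 22 2 n ≤ qPart 22 2 n :=
  QPart_two_le_qPart_of_bounds 3 1 9 4 160 1863 9 13 32 (by norm_num) (by norm_num)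
    rfl rfl rfl (by norm_num) (by norm_num) (by norm_num) (by norm_num) (by norm_num)
    (by norm_num) (by decide +kernel) n

theorem QPart_two_le_qPart_twenty_four (n : ℕ) : QPart 24 2 n ≤ qPart 24 2 n :=
  QPart_two_le_qPart_of_bounds 3 1 9 4 164 1944 8 13 32 (by norm_num) (by norm_num)
    rfl rfl rfl (by norm_num) (by norm_num) (by norm_num) (by norm_num) (by norm_num)
    (by norm_num) (by decide +kernel) n

theorem QPart_two_le_qPart_twenty_six (n : ℕ) : QPart 26 2 n ≤ qPart 26 2 n :=
  QPart_two_le_qPart_of_bounds 5 0 8 4 160 1856 8 12 31 (by norm_num) (by norm_num)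
    rfl rfl rfl (by norm_num) (by norm_num) (by norm_num) (by norm_num) (by norm_num)
    (by norm_num) (by decide +kernel) n

theorem QPart_two_le_qPart_twenty_eight (n : ℕ) : QPart 28 2 n ≤ qPart 28 2 n :=
  QPart_two_le_qPart_of_bounds 5 0 8 4 163 1920 8 12 31 (by norm_num) (by norm_num)
    rfl rfl rfl (by norm_num) (by norm_num) (by norm_num) (by norm_num) (by norm_num)
    (by norm_num) (by decide +kernel) n

theorem QPart_two_le_qPart_thirty (n : ℕ) : QPart 30 2 n ≤ qPart 30 2 n :=
  QPart_two_le_qPart_of_bounds 5 0 8 4 165 1984 8 11 34 (by norm_num) (by norm_num)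
    rfl rfl rfl (by norm_num) (by norm_num) (by norm_num) (by norm_num) (by norm_num)
    (by norm_num) (by decide +kernel) n

theorem QPart_two_le_qPart_thirty_two (n : ℕ) : QPart 32 2 n ≤ qPart 32 2 n :=
  QPart_two_le_qPart_of_bounds 5 0 8 4 168 2048 8 11 33 (by norm_num) (by norm_num)
    rfl rfl rfl (by norm_num) (by norm_num) (by norm_num) (by norm_num) (by norm_num)
    (by norm_num) (by decide +kernel) n

theorem QPart_two_le_qPart_thirty_four (n : ℕ) : QPart 34 2 n ≤ qPart 34 2 n :=
  QPart_two_le_qPart_of_bounds 5 0 8 4 171 2112 8 11 33 (by norm_num) (by norm_num)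
    rfl rfl rfl (by norm_num) (by norm_num) (by norm_num) (by norm_num) (by norm_num)
    (by norm_num) (by decide +kernel) n

theorem QPart_two_le_qPart_thirty_six (n : ℕ) : QPart 36 2 n ≤ qPart 36 2 n :=
  QPart_two_le_qPart_of_bounds 4 1 8 4 192 2688 8 12 40 (by norm_num) (by norm_num)
    rfl rfl rfl (by norm_num) (by norm_num) (by norm_num) (by norm_num) (by norm_num)
    (by norm_num) (by decide +kernel) n

theorem QPart_two_le_qPart_thirty_eight (n : ℕ) : QPart 38 2 n ≤ qPart 38 2 n :=
  QPart_two_le_qPart_of_bounds 4 1 8 4 195 2752 8 12 38 (by norm_num) (by norm_num)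
    rfl rfl rfl (by norm_num) (by norm_num) (by norm_num) (by norm_num) (by norm_num)
    (by norm_num) (by decide +kernel) n

theorem QPart_two_le_qPart_forty (n : ℕ) : QPart 40 2 n ≤ qPart 40 2 n :=
  QPart_two_le_qPart_of_bounds 4 1 8 4 197 2816 8 12 39 (by norm_num) (by norm_num)
    rfl rfl rfl (by norm_num) (by norm_num) (by norm_num) (by norm_num) (by norm_num)
    (by norm_num) (by decide +kernel) n

theorem QPart_two_le_qPart_forty_two (n : ℕ) : QPart 42 2 n ≤ qPart 42 2 n :=
  QPart_two_le_qPart_of_bounds 4 1 8 4 199 2880 8 12 40 (by norm_num) (by norm_num)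
    rfl rfl rfl (by norm_num) (by norm_num) (by norm_num) (by norm_num) (by norm_num)
    (by norm_num) (by decide +kernel) n

theorem QPart_two_le_qPart_forty_four (n : ℕ) : QPart 44 2 n ≤ qPart 44 2 n :=
  QPart_two_le_qPart_of_bounds 4 1 8 4 201 2944 8 12 41 (by norm_num) (by norm_num)
    rfl rfl rfl (by norm_num) (by norm_num) (by norm_num) (by norm_num) (by norm_num)
    (by norm_num) (by decide +kernel) n

theorem QPart_two_le_qPart_forty_six (n : ℕ) : QPart 46 2 n ≤ qPart 46 2 n :=
  QPart_two_le_qPart_of_bounds 4 1 8 4 203 3008 8 11 43 (by norm_num) (by norm_num)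
    rfl rfl rfl (by norm_num) (by norm_num) (by norm_num) (by norm_num) (by norm_num)
    (by norm_num) (by decide +kernel) n

theorem QPart_two_le_qPart_forty_eight (n : ℕ) : QPart 48 2 n ≤ qPart 48 2 n :=
  QPart_two_le_qPart_of_bounds 4 1 8 4 206 3072 8 11 40 (by norm_num) (by norm_num)
    rfl rfl rfl (by norm_num) (by norm_num) (by norm_num) (by norm_num) (by norm_num)
    (by norm_num) (by decide +kernel) n

theorem QPart_two_le_qPart_fifty (n : ℕ) : QPart 50 2 n ≤ qPart 50 2 n :=
  QPart_two_le_qPart_of_bounds 4 1 8 4 208 3136 8 11 41 (by norm_num) (by norm_num)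
    rfl rfl rfl (by norm_num) (by norm_num) (by norm_num) (by norm_num) (by norm_num)
    (by norm_num) (by decide +kernel) n

theorem QPart_two_le_qPart_fifty_two (n : ℕ) : QPart 52 2 n ≤ qPart 52 2 n :=
  QPart_two_le_qPart_of_bounds 4 1 8 4 210 3200 8 11 41 (by norm_num) (by norm_num)
    rfl rfl rfl (by norm_num) (by norm_num) (by norm_num) (by norm_num) (by norm_num)
    (by norm_num) (by decide +kernel) n

theorem QPart_two_le_qPart_fifty_four (n : ℕ) : QPart 54 2 n ≤ qPart 54 2 n :=
  QPart_two_le_qPart_of_bounds 4 1 8 4 212 3264 8 11 42 (by norm_num) (by norm_num)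
    rfl rfl rfl (by norm_num) (by norm_num) (by norm_num) (by norm_num) (by norm_num)
    (by norm_num) (by decide +kernel) n

theorem QPart_two_le_qPart_fifty_six (n : ℕ) : QPart 56 2 n ≤ qPart 56 2 n :=
  QPart_two_le_qPart_of_bounds 4 1 8 4 214 3328 8 11 43 (by norm_num) (by norm_num)
    rfl rfl rfl (by norm_num) (by norm_num) (by norm_num) (by norm_num) (by norm_num)
    (by norm_num) (by decide +kernel) n

theorem QPart_two_le_qPart_fifty_eight (n : ℕ) : QPart 58 2 n ≤ qPart 58 2 n :=
  QPart_two_le_qPart_of_bounds 6 0 8 4 232 3904 8 12 45 (by norm_num) (by norm_num)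
    rfl rfl rfl (by norm_num) (by norm_num) (by norm_num) (by norm_num) (by norm_num)
    (by norm_num) (by decide +kernel) n

theorem QPart_two_le_qPart_sixty (n : ℕ) : QPart 60 2 n ≤ qPart 60 2 n :=
  QPart_two_le_qPart_of_bounds 6 0 8 4 234 3968 8 11 46 (by norm_num) (by norm_num)
    rfl rfl rfl (by norm_num) (by norm_num) (by norm_num) (by norm_num) (by norm_num)
    (by norm_num) (by decide +kernel) n

/-- For every even d with 6 ≤ d ≤ 60 and every n ≥ 0, q_d^{(2)}(n) ≥ Q_d^{(2)}(n). -/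
theorem delta_nonneg_even (d n : ℕ) (hd : Even d) (hd6 : 6 ≤ d) (hd60 : d ≤ 60) :
    QPart d 2 n ≤ qPart d 2 n := by
  obtain ⟨m, rfl⟩ := hd
  have h3 : 3 ≤ m := by omega
  have h30 : m ≤ 30 := by omega
  interval_cases m
  · exact QPart_two_le_qPart_six n
  · exact QPart_two_le_qPart_eight n
  · exact QPart_two_le_qPart_ten n
  · exact QPart_two_le_qPart_twelve n
  · exact QPart_two_le_qPart_fourteen n
  · exact QPart_two_le_qPart_sixteen n
  · exact QPart_two_le_qPart_eighteen n
  · exact QPart_two_le_qPart_twenty n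
  · exact QPart_two_le_qPart_twenty_two n
  · exact QPart_two_le_qPart_twenty_four n
  · exact QPart_two_le_qPart_twenty_six n
  · exact QPart_two_le_qPart_twenty_eight n
  · exact QPart_two_le_qPart_thirty n
  · exact QPart_two_le_qPart_thirty_two n
  · exact QPart_two_le_qPart_thirty_four n
  · exact QPart_two_le_qPart_thirty_six n
  · exact QPart_two_le_qPart_thirty_eight n
  · exact QPart_two_le_qPart_forty n
  · exact QPart_two_le_qPart_forty_two n
  · exact QPart_two_le_qPart_forty_four n
  · exact QPart_two_le_qPart_forty_six n
  · exact QPart_two_le_qPart_forty_eight n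
  · exact QPart_two_le_qPart_fifty n
  · exact QPart_two_le_qPart_fifty_two n
  · exact QPart_two_le_qPart_fifty_four n
  · exact QPart_two_le_qPart_fifty_six n
  · exact QPart_two_le_qPart_fifty_eight n
  · exact QPart_two_le_qPart_sixty n
end
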